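/- arXiv:0810.0654 — 2 statements merged into one kernel-verified Lean document; each statement's English description precedes it below -/
import Mathlib

section
/- Assume p < 2 and N ≤ α < δ. (i) If α < α*, then for any a ≠ 0 the global solution w(·,a) has only finitely many zeros. (ii) There exists ᾱ ∈ (max(N, α*), δ) (depending on N, p, q) such that whenever α ∈ (ᾱ, δ), every solution w(·,a) with a ≠ 0 has infinitely many zeros. -/
open Set Filter Topology Asymptotics

/-- The p-Laplacian nonlinearity φ_p(x) = |x|^{p-2} x. -/
noncomputable def phiP (p x : ℝ) : ℝ := |x| ^ (p - 2) * x

/-- `w` is a solution of equation (E) on the interval `I ⊆ (0,∞)`: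
`w` is C¹ on `I`, `|w'|^{p-2} w'` is C¹ on `I`, and the equation
`(|w'|^{p-2}w')' + ((N-1)/r)|w'|^{p-2}w' + r w' + α w + |w|^{q-1} w = 0`
holds on `I` (derivatives taken within `I`). -/
def IsSolutionOn (N : ℕ) (p q α : ℝ) (w : ℝ → ℝ) (I : Set ℝ) : Prop :=
  ContDiffOn ℝ 1 w I ∧
  ContDiffOn ℝ 1 (fun r => phiP p (derivWithin w I r)) I ∧
  ∀ r ∈ I,
    derivWithin (fun s => phiP p (derivWithin w I s)) I r
      + ((N : ℝ) - 1) / r * phiP p (derivWithin w I r)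
      + r * derivWithin w I r + α * w r + |w r| ^ (q - 1) * w r = 0

/-- `w` is the global solution of (E) on `[0,∞)` with `w(0) = a`, `w'(0) = 0`:
`w ∈ C¹([0,∞))`, `|w'|^{p-2}w' ∈ C¹([0,∞))`, and (E) holds on `(0,∞)`. -/
def IsGlobalSolution (N : ℕ) (p q α a : ℝ) (w : ℝ → ℝ) : Prop :=
  ContDiffOn ℝ 1 w (Ici 0) ∧
  ContDiffOn ℝ 1 (fun r => phiP p (derivWithin w (Ici 0) r)) (Ici 0) ∧
  (∀ r ∈ Ioi (0 : ℝ),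
    derivWithin (fun s => phiP p (derivWithin w (Ici 0) s)) (Ici 0) r
      + ((N : ℝ) - 1) / r * phiP p (derivWithin w (Ici 0) r)
      + r * derivWithin w (Ici 0) r + α * w r + |w r| ^ (q - 1) * w r = 0) ∧
  w 0 = a ∧ derivWithin w (Ici 0) 0 = 0

/-- `r` is an isolated zero of `w` relative to the set `I`. -/
def IsIsolatedZeroOn (w : ℝ → ℝ) (I : Set ℝ) (r : ℝ) : Prop :=
  r ∈ I ∧ w r = 0 ∧ ∀ᶠ s in 𝓝[I \ {r}] r, w s ≠ 0

/-- `w` has at least `n` isolated zeros in `(0,∞)`. -/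
def HasAtLeastIsolatedZeros (w : ℝ → ℝ) (n : ℕ) : Prop :=
  ∃ z : Fin n → ℝ, StrictMono z ∧ ∀ i, 0 < z i ∧ IsIsolatedZeroOn w (Ici 0) (z i)

/-! ### Calculus helpers -/

theorem monotoneOn_of_hasDerivAt_nonneg {D : Set ℝ} (hD : Convex ℝ D) {f f' : ℝ → ℝ}
    (hf : ∀ x ∈ D, HasDerivAt f (f' x) x) (h0 : ∀ x ∈ D, 0 ≤ f' x) : MonotoneOn f D :=
  monotoneOn_of_deriv_nonneg hD (fun x hx => (hf x hx).continuousAt.continuousWithinAt)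
    (fun x hx => (hf x (interior_subset hx)).differentiableAt.differentiableWithinAt)
    (fun x hx => by rw [(hf x (interior_subset hx)).deriv]; exact h0 x (interior_subset hx))

theorem antitoneOn_of_hasDerivAt_nonpos {D : Set ℝ} (hD : Convex ℝ D) {f f' : ℝ → ℝ}
    (hf : ∀ x ∈ D, HasDerivAt f (f' x) x) (h0 : ∀ x ∈ D, f' x ≤ 0) : AntitoneOn f D :=
  antitoneOn_of_deriv_nonpos hD (fun x hx => (hf x hx).continuousAt.continuousWithinAt)
    (fun x hx => (hf x (interior_subset hx)).differentiableAt.differentiableWithinAt)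
    (fun x hx => by rw [(hf x (interior_subset hx)).deriv]; exact h0 x (interior_subset hx))

theorem le_of_hasDerivAt_neg_on_level {f f' : ℝ → ℝ} {a b K : ℝ} (hab : a ≤ b)
    (hf : ∀ x ∈ Icc a b, HasDerivAt f (f' x) x) (ha : f a ≤ K)
    (hK : ∀ x ∈ Icc a b, f x = K → f' x < 0) : f b ≤ K :=
  image_le_of_deriv_right_lt_deriv_boundary' (B := fun _ => K) (B' := fun _ => 0)
    (fun x hx => (hf x hx).continuousAt.continuousWithinAt)
    (fun x hx => (hf x (Ico_subset_Icc_self hx)).hasDerivWithinAt) ha continuousOn_const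
    (fun _ _ => hasDerivWithinAt_const _ _ _)
    (fun x hx => hK x (Ico_subset_Icc_self hx)) (right_mem_Icc.2 hab)

theorem ge_of_hasDerivAt_pos_on_level {f f' : ℝ → ℝ} {a b K : ℝ} (hab : a ≤ b)
    (hf : ∀ x ∈ Icc a b, HasDerivAt f (f' x) x) (ha : K ≤ f a)
    (hK : ∀ x ∈ Icc a b, f x = K → 0 < f' x) : K ≤ f b := by
  have := le_of_hasDerivAt_neg_on_level (f := fun x => -f x) (f' := fun x => -f' x) (K := -K) hab
    (fun x hx => (hf x hx).neg) (by simpa using ha)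
    (fun x hx h => by have := hK x hx (by simpa using h); linarith)
  simpa using this

theorem eventually_nonneg_nhdsGT_of_hasDerivAt {f : ℝ → ℝ} {f' x : ℝ} (hf : HasDerivAt f f' x)
    (h0 : 0 ≤ f x) (h : f x = 0 → 0 < f') : ∀ᶠ t in 𝓝[>] x, 0 ≤ f t := by
  rcases h0.lt_or_eq with h1 | h1
  · exact nhdsWithin_le_nhds
      ((hf.continuousAt.eventually (lt_mem_nhds h1)).mono fun t ht => le_of_lt ht)
  · have h2 := h h1.symm
    have h3 := hf.tendsto_slope
    have h4 : ∀ᶠ t in 𝓝[≠] x, 0 < slope f x t := h3.eventually (lt_mem_nhds h2)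
    have h5 : 𝓝[>] x ≤ 𝓝[≠] x := nhdsWithin_mono _ (fun t ht => ne_of_gt ht)
    filter_upwards [h5 h4, self_mem_nhdsWithin] with t ht htx
    rw [slope_def_field, ← h1, sub_zero] at ht
    have : (0 : ℝ) < t - x := sub_pos.2 htx
    exact le_of_lt ((div_pos_iff_of_pos_right this).1 ht)

/-! ### Signed powers -/

theorem hasDerivAt_abs_rpow_mul_self {s : ℝ} (hs : 0 < s) (x : ℝ) :
    HasDerivAt (fun x : ℝ => |x| ^ s * x) ((s + 1) * |x| ^ s) x := by
  rcases eq_or_ne x 0 with rfl | hx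
  · have : HasDerivAt (fun x : ℝ => |x| ^ s * x) 0 0 := by
      rw [hasDerivAt_iff_tendsto_slope]
      have h1 : Tendsto (fun t : ℝ => |t| ^ s) (𝓝[≠] 0) (𝓝 0) := by
        have h2 : Continuous (fun t : ℝ => |t| ^ s) :=
          continuous_abs.rpow_const (fun _ => Or.inr hs.le)
        have := (h2.tendsto 0).mono_left (nhdsWithin_le_nhds (s := {0}ᶜ))
        simpa [Real.zero_rpow hs.ne'] using this
      refine h1.congr' ?_
      filter_upwards [self_mem_nhdsWithin] with t ht
      have ht' : t ≠ 0 := ht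
      rw [slope_def_field]
      field_simp
      simp
    simpa [Real.zero_rpow hs.ne'] using this
  · have h1 : HasDerivAt (fun x : ℝ => |x| ^ s) (s * |x| ^ (s - 2) * x) x := by
      have h2 := (hasDerivAt_abs hx).rpow_const (p := s) (Or.inl (abs_ne_zero.2 hx))
      convert h2 using 1
      have h3 : |x| ^ (s - 1) = |x| ^ (s - 2) * |x| := by
        rw [← Real.rpow_add_one (abs_ne_zero.2 hx)]; ring_nf
      rw [h3]
      have h4 : (SignType.sign x : ℝ) * |x| = x := sign_mul_abs x
      calc s * |x| ^ (s - 2) * x = s * |x| ^ (s - 2) * ((SignType.sign x : ℝ) * |x|) := by rw [h4]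
        _ = _ := by ring
    refine (h1.mul (hasDerivAt_id' x)).congr_deriv ?_
    have h5 : |x| ^ s = |x| ^ (s - 2) * x ^ 2 := by
      rw [← sq_abs, ← Real.rpow_natCast, ← Real.rpow_add (abs_pos.2 hx)]; norm_num
    rw [h5]; ring

theorem continuous_abs_rpow {s : ℝ} (hs : 0 ≤ s) : Continuous (fun x : ℝ => |x| ^ s) :=
  continuous_abs.rpow_const (fun _ => Or.inr hs)

theorem abs_rpow_mul_sq {s : ℝ} (hs : 0 ≤ s) (x : ℝ) : |x| ^ s * x ^ 2 = |x| ^ (s + 2) := by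
  rw [Real.rpow_add_of_nonneg (abs_nonneg x) hs (by norm_num), ← sq_abs x]
  norm_num

theorem abs_rpow_mul_abs {s : ℝ} (hs : 0 ≤ s) (x : ℝ) : |x| ^ s * |x| = |x| ^ (s + 1) := by
  rw [Real.rpow_add_of_nonneg (abs_nonneg x) hs (by norm_num)]
  norm_num

theorem hasDerivAt_abs_rpow_add_two {s : ℝ} (hs : 0 ≤ s) (x : ℝ) :
    HasDerivAt (fun x : ℝ => |x| ^ (s + 2) / (s + 2)) (|x| ^ s * x) x := by
  refine ((hasDerivAt_abs_rpow x (p := s + 2) (by linarith)).div_const (s + 2)).congr_deriv ?_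
  have : s + 2 ≠ 0 := by linarith
  rw [add_sub_cancel_right]
  field_simp

/-! ### Young type inequalities -/

theorem rpow_mul_rpow_le_one_add_rpow {a b A B γ x v : ℝ} (ha : 0 ≤ a) (hb : 0 ≤ b) (hA : 0 < A)
    (hB : 0 < B) (hγ : a / A + b / B ≤ γ) (hx : 0 ≤ x) (hv : 0 ≤ v) :
    x ^ a * v ^ b ≤ (1 + (x ^ A + v ^ B)) ^ γ := by
  have hxA := Real.rpow_nonneg hx A
  have hvB := Real.rpow_nonneg hv B
  have h1 : x ^ a ≤ (1 + (x ^ A + v ^ B)) ^ (a / A) := by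
    calc x ^ a = (x ^ A) ^ (a / A) := by rw [← Real.rpow_mul hx]; field_simp
      _ ≤ _ := Real.rpow_le_rpow hxA (by linarith) (by positivity)
  have h2 : v ^ b ≤ (1 + (x ^ A + v ^ B)) ^ (b / B) := by
    calc v ^ b = (v ^ B) ^ (b / B) := by rw [← Real.rpow_mul hv]; field_simp
      _ ≤ _ := Real.rpow_le_rpow hvB (by linarith) (by positivity)
  calc x ^ a * v ^ b ≤ (1 + (x ^ A + v ^ B)) ^ (a / A) * (1 + (x ^ A + v ^ B)) ^ (b / B) := by
        gcongr
    _ = (1 + (x ^ A + v ^ B)) ^ (a / A + b / B) := by rw [Real.rpow_add (by linarith)]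
    _ ≤ _ := Real.rpow_le_rpow_of_exponent_le (by linarith) hγ

theorem exists_rpow_le_mul_add {γ η : ℝ} (h0 : 0 ≤ γ) (h1 : γ < 1) (hη : 0 < η) :
    ∃ C, 0 ≤ C ∧ ∀ t : ℝ, 0 ≤ t → t ^ γ ≤ η * t + C := by
  refine ⟨(η⁻¹ ^ γ) ^ (1 - γ)⁻¹, by positivity, fun t ht => ?_⟩
  set K := (η⁻¹ ^ γ) ^ (1 - γ)⁻¹ with hK
  have hK0 : 0 ≤ K := by positivity
  have h2 : K ^ (1 - γ) = η⁻¹ ^ γ := by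
    rw [hK, ← Real.rpow_mul (by positivity), inv_mul_cancel₀ (by linarith), Real.rpow_one]
  have h3 := Real.geom_mean_le_arith_mean2_weighted h0 (sub_nonneg.2 h1.le)
    (mul_nonneg hη.le ht) hK0 (by ring)
  have h4 : (η * t) ^ γ * K ^ (1 - γ) = t ^ γ := by
    rw [h2, Real.mul_rpow hη.le ht, Real.inv_rpow hη.le]
    have : η ^ γ ≠ 0 := (Real.rpow_pos_of_pos hη _).ne'
    field_simp
  rw [h4] at h3
  nlinarith [mul_nonneg hη.le ht]

theorem exists_rpow_mul_rpow_le {a b A B η : ℝ} (ha : 0 ≤ a) (hb : 0 ≤ b) (hA : 0 < A)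
    (hB : 0 < B) (h : a / A + b / B < 1) (hη : 0 < η) :
    ∃ C, 0 ≤ C ∧ ∀ x v : ℝ, 0 ≤ x → 0 ≤ v → x ^ a * v ^ b ≤ η * (x ^ A + v ^ B) + C := by
  obtain ⟨C, hC, H⟩ := exists_rpow_le_mul_add (γ := a / A + b / B) (by positivity) h hη
  refine ⟨η + C, by positivity, fun x v hx hv => ?_⟩
  have h1 := rpow_mul_rpow_le_one_add_rpow ha hb hA hB le_rfl hx hv
  have hxA := Real.rpow_nonneg hx A
  have hvB := Real.rpow_nonneg hv B
  have h2 := H (1 + (x ^ A + v ^ B)) (by linarith)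
  linarith

/-- Solutions of a differential inequality with superlinear damping are bounded after a fixed
time, independently of their initial value. -/
theorem exists_bound_of_superlinear_damping {γ c C D : ℝ} (hγ0 : 0 < γ) (hγ1 : γ < 1) (hc : 0 < c)
    (hC : 0 ≤ C) (hD : 0 < D) :
    ∃ K, ∀ F F' S : ℝ → ℝ, (∀ r ∈ Icc (1 / 2 : ℝ) 1, HasDerivAt F (F' r) r) →
      (∀ r ∈ Icc (1 / 2 : ℝ) 1, 0 ≤ S r ∧ F' r ≤ C - c * S r ∧ F r ≤ D * (1 + S r) ^ γ) →
      F 1 ≤ K := by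
  set k := 1 / γ with hk
  have hk1 : 1 < k := by rw [hk]; exact one_lt_one_div hγ0 hγ1
  set β := 1 / (k - 1) with hβ
  have hβ0 : 0 < β := by rw [hβ]; exact one_div_pos.2 (by linarith)
  have hβk : β * k = β + 1 := by
    rw [hβ]; have : k - 1 ≠ 0 := by linarith
    field_simp; ring
  set c2 := c / D ^ k with hc2
  have hc20 : 0 < c2 := by positivity
  obtain ⟨K0, hK0, hK1⟩ : ∃ K0 : ℝ, 0 < K0 ∧ C + c + β * K0 < c2 * K0 ^ k := by
    have h1 : Tendsto (fun K : ℝ => K ^ (k - 1)) atTop atTop := tendsto_rpow_atTop (by linarith)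
    obtain ⟨K0, h2, h3⟩ := ((h1.eventually_gt_atTop ((C + c + β) / c2)).and
      (eventually_ge_atTop (1 : ℝ))).exists
    refine ⟨K0, by linarith, ?_⟩
    rw [div_lt_iff₀ hc20] at h2
    have h4 : K0 ^ k = K0 ^ (k - 1) * K0 := by
      rw [← Real.rpow_add_one (by linarith), sub_add_cancel]
    rw [h4]
    have : (C + c + β) * K0 < K0 ^ (k - 1) * c2 * K0 := by
      apply mul_lt_mul_of_pos_right h2; linarith
    nlinarith
  refine ⟨K0 * (1 / 2) ^ (-β), fun F F' S hF hS => ?_⟩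
  -- an upper bound of `F` near `1 / 2`
  obtain ⟨M, hM⟩ := (isCompact_Icc (a := (1 / 2 : ℝ)) (b := 1)).bddAbove_image
    (fun r hr => (hF r hr).continuousAt.continuousWithinAt)
  obtain ⟨x0, hx0M, hx0⟩ : ∃ x0 : ℝ, M ≤ K0 * x0 ^ (-β) ∧ x0 ∈ Ioo (0 : ℝ) (1 / 2) := by
    have h1 : Tendsto (fun x : ℝ => K0 * x ^ (-β)) (𝓝[>] 0) atTop :=
      (tendsto_rpow_neg_nhdsGT_zero (by linarith)).const_mul_atTop hK0
    exact ((h1.eventually_ge_atTop M).and (Ioo_mem_nhdsGT (by norm_num))).exists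
  have hsub : ∀ x ∈ Icc (1 / 2 + x0) 1, x ∈ Icc (1 / 2 : ℝ) 1 := fun x hx =>
    ⟨by linarith [hx.1, hx0.1], hx.2⟩
  have hB : ∀ x ∈ Icc (1 / 2 + x0) 1,
      HasDerivAt (fun x => K0 * (x - 1 / 2) ^ (-β)) (K0 * (-β * (x - 1 / 2) ^ (-β - 1))) x := by
    intro x hx
    have h1 : HasDerivAt (fun x : ℝ => x - 1 / 2) 1 x := (hasDerivAt_id x).sub_const _
    have h2 := (h1.rpow_const (p := -β) (Or.inl (by linarith [hx.1, hx0.1]))).const_mul K0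
    refine h2.congr_deriv ?_
    ring
  have hfin := image_le_of_deriv_right_lt_deriv_boundary' (f := F) (f' := F') (a := 1 / 2 + x0)
    (b := 1) (B := fun x => K0 * (x - 1 / 2) ^ (-β))
    (B' := fun x => K0 * (-β * (x - 1 / 2) ^ (-β - 1)))
    (fun x hx => (hF x (hsub x hx)).continuousAt.continuousWithinAt)
    (fun x hx => (hF x (hsub x (Ico_subset_Icc_self hx))).hasDerivWithinAt)
    (by
      simp only [add_sub_cancel_left]
      exact (hM (mem_image_of_mem _
        (hsub _ ⟨le_rfl, by linarith [hx0.2]⟩))).trans hx0M)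
    (fun x hx => (hB x hx).continuousAt.continuousWithinAt)
    (fun x hx => (hB x (Ico_subset_Icc_self hx)).hasDerivWithinAt)
    (by
      intro x hx hFx
      obtain ⟨hS0, hS1, hS2⟩ := hS x (hsub x (Ico_subset_Icc_self hx))
      have hX0 : 0 < x - 1 / 2 := by linarith [hx.1, hx0.1]
      have hX1 : x - 1 / 2 ≤ 1 := by linarith [hx.2]
      set X := (x - 1 / 2) ^ (-β - 1) with hX
      have hXge : 1 ≤ X := Real.one_le_rpow_of_pos_of_le_one_of_nonpos hX0 hX1 (by linarith)
      have hFpos : 0 ≤ F x := by rw [hFx]; positivity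
      have h1 : F x ^ k ≤ D ^ k * (1 + S x) := by
        calc F x ^ k ≤ (D * (1 + S x) ^ γ) ^ k := Real.rpow_le_rpow hFpos hS2 (by linarith)
          _ = D ^ k * (1 + S x) := by
            rw [Real.mul_rpow hD.le (by positivity), ← Real.rpow_mul (by linarith), hk,
              mul_one_div_cancel hγ0.ne', Real.rpow_one]
      have h2 : F x ^ k = K0 ^ k * X := by
        rw [hFx, Real.mul_rpow hK0.le (by positivity), ← Real.rpow_mul hX0.le, hX]
        congr 2; linarith
      have h3 : c2 * (K0 ^ k * X) ≤ c * (1 + S x) := by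
        rw [← h2, hc2, div_mul_eq_mul_div, div_le_iff₀ (by positivity)]
        nlinarith
      have h4 : (C + c + β * K0) * X < c2 * K0 ^ k * X :=
        mul_lt_mul_of_pos_right hK1 (by linarith)
      nlinarith)
    (right_mem_Icc.2 (by linarith [hx0.2]))
  have : (1 : ℝ) - 1 / 2 = 1 / 2 := by norm_num
  rw [this] at hfin
  exact hfin

/-! ### The radial equation as a first order system -/

/-- The radial equation in the unknowns `w` and `P = |w'|^{p-2} w'`, with `s = (2 - p) / (p - 1)`,
so that `w' = |P|^s P`, and with `k = q - 1`. -/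
structure IsRadialSystem (n s k α : ℝ) (w P : ℝ → ℝ) : Prop where
  hasDerivAt_fst : ∀ r, 0 < r → HasDerivAt w (|P r| ^ s * P r) r
  hasDerivAt_snd : ∀ r, 0 < r → HasDerivAt P
    (-((n - 1) / r * P r) - r * (|P r| ^ s * P r) - α * w r - |w r| ^ k * w r) r

/-- The energy of the radial equation. -/
noncomputable def radialEnergy (s k α : ℝ) (w P : ℝ → ℝ) (r : ℝ) : ℝ :=
  |P r| ^ (s + 2) / (s + 2) + α * w r ^ 2 / 2 + |w r| ^ (k + 2) / (k + 2)

theorem sq_abs_rpow_mul_self {s : ℝ} (hs : 0 ≤ s) (x : ℝ) :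
    (|x| ^ s * x) ^ 2 = |x| ^ (2 * s + 2) := by
  rw [mul_pow, ← abs_rpow_mul_sq (s := 2 * s) (by linarith), two_mul,
    Real.rpow_add_of_nonneg (abs_nonneg x) hs hs, sq]

namespace IsRadialSystem

variable {n s k α : ℝ} {w P : ℝ → ℝ}

theorem hasDerivAt_radialEnergy (h : IsRadialSystem n s k α w P) (hs : 0 ≤ s) (hk : 0 ≤ k)
    {r : ℝ} (hr : 0 < r) : HasDerivAt (radialEnergy s k α w P)
      (-((n - 1) / r * |P r| ^ (s + 2)) - r * |P r| ^ (2 * s + 2)) r := by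
  have hw := h.hasDerivAt_fst r hr
  have hP := h.hasDerivAt_snd r hr
  have h1 := (hasDerivAt_abs_rpow_add_two hs (P r)).comp r hP
  have h2 := ((hw.pow 2).const_mul α).div_const 2
  have h3 := (hasDerivAt_abs_rpow_add_two hk (w r)).comp r hw
  refine ((h1.add h2).add h3).congr_deriv ?_
  rw [← abs_rpow_mul_sq hs, ← sq_abs_rpow_mul_self hs]
  push_cast
  ring

theorem antitoneOn_radialEnergy (h : IsRadialSystem n s k α w P) (hn : 1 ≤ n) (hs : 0 ≤ s)
    (hk : 0 ≤ k) : AntitoneOn (radialEnergy s k α w P) (Ioi 0) := by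
  refine antitoneOn_of_hasDerivAt_nonpos (convex_Ioi 0)
    (fun r hr => h.hasDerivAt_radialEnergy hs hk hr) (fun r hr => ?_)
  have hr' : 0 < r := hr
  have h1 : 0 ≤ (n - 1) / r := div_nonneg (by linarith) hr'.le
  have h2 : 0 ≤ |P r| ^ (s + 2) := by positivity
  have h3 : 0 ≤ |P r| ^ (2 * s + 2) := by positivity
  nlinarith [mul_nonneg h1 h2, mul_nonneg hr'.le h3]

end IsRadialSystem

set_option maxHeartbeats 1000000 in
/-- The energy at radius `1` has a bound which does not depend on the initial value. -/
theorem exists_radialEnergy_one_le {n s k A₀ : ℝ} (hn : 1 ≤ n) (hs : 0 < s) (hk : 0 < k) :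
    ∃ K, ∀ α w P, 0 ≤ α → α ≤ A₀ → IsRadialSystem n s k α w P →
      radialEnergy s k α w P 1 ≤ K := by
  by_cases hA₀ : 0 ≤ A₀
  swap
  · exact ⟨0, fun α w P h1 h2 _ => absurd (h1.trans h2) hA₀⟩
  obtain ⟨t, ht0, htk, hts⟩ : ∃ t : ℝ, 0 < t ∧ t < k ∧ t * (2 * s + 2) < s := by
    refine ⟨min k (s / (2 * s + 2)) / 2, by positivity, ?_, ?_⟩
    · linarith [min_le_left k (s / (2 * s + 2))]
    · have h1 := min_le_right k (s / (2 * s + 2))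
      have h2 : 0 < s / (2 * s + 2) := by positivity
      rw [← lt_div_iff₀ (by positivity)]
      linarith
  set A := 2 * s + 2 with hA
  set B := k + 2 + t with hB
  have hA0 : 0 < A := by positivity
  have hB0 : 0 < B := by positivity
  have htB : (t + 1) / B < 1 / 2 := by rw [div_lt_div_iff₀ hB0 two_pos]; linarith
  have hA2 : 1 / A < 1 / 2 := by rw [div_lt_div_iff₀ hA0 two_pos]; linarith
  have hsA : (s + 1) / A = 1 / 2 := by rw [hA]; field_simp
  have hsA2 : (s + 2) / A + t / B < 1 := by
    have h1 : t / B ≤ t := div_le_self ht0.le (by linarith)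
    have h2 : t < s / A := by rwa [lt_div_iff₀ hA0]
    have h3 : (s + 2) / A + s / A = 1 := by rw [hA]; field_simp; ring
    linarith
  obtain ⟨C1, hC1, H1⟩ := exists_rpow_mul_rpow_le (a := s + 2) (b := t) (A := A) (B := B)
    (η := 1 / (16 * (t + 1))) (by positivity) ht0.le hA0 hB0 hsA2 (by positivity)
  obtain ⟨C2, hC2, H2⟩ := exists_rpow_mul_rpow_le (a := 1) (b := t + 1) (A := A) (B := B)
    (η := 1 / (32 * n)) (by positivity) (by linarith) hA0 hB0 (by linarith) (by positivity)
  obtain ⟨C3, hC3, H3⟩ := exists_rpow_mul_rpow_le (a := s + 1) (b := t + 1) (A := A) (B := B)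
    (η := 1 / 16) (by positivity) (by linarith) hA0 hB0 (by linarith) (by positivity)
  obtain ⟨C4, hC4, H4⟩ := exists_rpow_mul_rpow_le (a := 1) (b := t + 1) (A := s + 2) (B := k + 2)
    (η := 1 / (2 * ((s + 2) * (k + 2)))) (by positivity) (by linarith) (by linarith) (by linarith)
    (by
      have h1 : (t + 1) / (k + 2) < (t + 1) / 2 :=
        div_lt_div_of_pos_left (by linarith) two_pos (by linarith)
      have h2 : t < s / (s + 2) := by rw [lt_div_iff₀ (by linarith)]; nlinarith
      have h3 : 1 / (s + 2) = (1 - s / (s + 2)) / 2 := by field_simp; ring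
      linarith) (by positivity)
  obtain ⟨γ, hγ0, hγ1, g1, g2, g3, g4⟩ : ∃ γ : ℝ, 0 < γ ∧ γ < 1 ∧ (s + 2) / A ≤ γ ∧ 2 / B ≤ γ ∧
      (k + 2) / B ≤ γ ∧ 1 / A + (t + 1) / B ≤ γ := by
    refine ⟨max (max ((s + 2) / A) (2 / B)) (max ((k + 2) / B) (1 / A + (t + 1) / B)), ?_, ?_,
      ?_, ?_, ?_, ?_⟩
    · exact lt_max_of_lt_left (lt_max_of_lt_left (by positivity))
    · refine max_lt (max_lt ?_ ?_) (max_lt ?_ ?_)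
      · rw [div_lt_one hA0]; linarith
      · rw [div_lt_one hB0]; linarith
      · rw [div_lt_one hB0]; linarith
      · linarith
    · exact (le_max_left _ _).trans (le_max_left _ _)
    · exact (le_max_right _ _).trans (le_max_left _ _)
    · exact (le_max_left _ _).trans (le_max_right _ _)
    · exact (le_max_right _ _).trans (le_max_right _ _)
  obtain ⟨K, HK⟩ := exists_bound_of_superlinear_damping (γ := γ) (c := 1 / 4)
    (C := (t + 1) * C1 + 2 * n * C2 + C3) (D := 3 + A₀) hγ0 hγ1 (by norm_num)
    (by positivity) (by positivity)
  refine ⟨2 * (K + C4), fun α w P hα0 hαA h => ?_⟩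
  obtain ⟨F', hF'⟩ : ∃ F' : ℝ → ℝ, ∀ r, F' r =
      (-((n - 1) / r * |P r| ^ (s + 2)) - r * |P r| ^ (2 * s + 2)) +
    ((t + 1) * |w r| ^ t * (|P r| ^ s * P r) * P r + |w r| ^ t * w r *
    (-((n - 1) / r * P r) - r * (|P r| ^ s * P r) - α * w r - |w r| ^ k * w r)) := ⟨_, fun _ => rfl⟩
  have hder : ∀ r, 0 < r → HasDerivAt
      (fun r => radialEnergy s k α w P r + |w r| ^ t * w r * P r) (F' r) r := by
    intro r hr
    have h1 := (hasDerivAt_abs_rpow_mul_self ht0 (w r)).comp r (h.hasDerivAt_fst r hr)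
    rw [hF']
    exact (h.hasDerivAt_radialEnergy hs.le hk.le hr).add (h1.mul (h.hasDerivAt_snd r hr))
  have hcross : ∀ r, |(|w r| ^ t * w r * P r)| = |P r| ^ (1 : ℝ) * |w r| ^ (t + 1) := by
    intro r
    rw [abs_mul, abs_mul, abs_of_nonneg (by positivity : 0 ≤ |w r| ^ t), abs_rpow_mul_abs ht0.le,
      Real.rpow_one, mul_comm]
  have hK1 := HK _ F' (fun r => |P r| ^ A + |w r| ^ B)
    (fun r hr => hder r (by linarith [hr.1])) (by
      intro r hr
      have hr0 : 0 < r := by linarith [hr.1]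
      have hS0 : 0 ≤ |P r| ^ A + |w r| ^ B := by positivity
      refine ⟨hS0, ?_, ?_⟩
      · have e1 := H1 |P r| |w r| (abs_nonneg _) (abs_nonneg _)
        have e2 := H2 |P r| |w r| (abs_nonneg _) (abs_nonneg _)
        have e3 := H3 |P r| |w r| (abs_nonneg _) (abs_nonneg _)
        have t1 : (t + 1) * |w r| ^ t * (|P r| ^ s * P r) * P r =
            (t + 1) * (|P r| ^ (s + 2) * |w r| ^ t) := by
          rw [← abs_rpow_mul_sq hs.le]; ring
        have t2 : |w r| ^ t * w r * (-((n - 1) / r * P r)) ≤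
            2 * n * (|P r| ^ (1 : ℝ) * |w r| ^ (t + 1)) := by
          have a1 : (n - 1) / r ≤ 2 * n := by
            rw [div_le_iff₀ hr0]; nlinarith [hr.1]
          have a2 : 0 ≤ (n - 1) / r := div_nonneg (by linarith) hr0.le
          have a3 := neg_abs_le (|w r| ^ t * w r * P r)
          rw [hcross] at a3
          have a4 : 0 ≤ |P r| ^ (1 : ℝ) * |w r| ^ (t + 1) := by positivity
          nlinarith [mul_le_mul_of_nonneg_right a1 a4, mul_le_mul_of_nonneg_left a3 a2]
        have t3 : |w r| ^ t * w r * (-(r * (|P r| ^ s * P r))) ≤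
            |P r| ^ (s + 1) * |w r| ^ (t + 1) := by
          have a1 : |(|w r| ^ t * w r * (|P r| ^ s * P r))| =
              |P r| ^ (s + 1) * |w r| ^ (t + 1) := by
            rw [abs_mul, abs_mul, abs_mul, abs_of_nonneg (by positivity : 0 ≤ |w r| ^ t),
              abs_of_nonneg (by positivity : 0 ≤ |P r| ^ s), abs_rpow_mul_abs ht0.le,
              abs_rpow_mul_abs hs.le, mul_comm]
          have a2 := neg_abs_le (|w r| ^ t * w r * (|P r| ^ s * P r))
          rw [a1] at a2
          have a4 : 0 ≤ |P r| ^ (s + 1) * |w r| ^ (t + 1) := by positivity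
          nlinarith [hr.2, mul_le_mul_of_nonneg_left a2 hr0.le,
            mul_le_mul_of_nonneg_right hr.2 a4]
        have t4 : 0 ≤ |w r| ^ t * w r * (α * w r) := by
          have : |w r| ^ t * w r * (α * w r) = α * (|w r| ^ t * w r ^ 2) := by ring
          rw [this]; positivity
        have t5 : |w r| ^ t * w r * (|w r| ^ k * w r) = |w r| ^ B := by
          rw [show B = (t + k) + 2 by rw [hB]; ring, ← abs_rpow_mul_sq (by linarith),
            Real.rpow_add_of_nonneg (abs_nonneg _) ht0.le hk.le]
          ring
        have t6 : 0 ≤ (n - 1) / r * |P r| ^ (s + 2) :=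
          mul_nonneg (div_nonneg (by linarith) hr0.le) (by positivity)
        have t7 : 1 / 2 * |P r| ^ A ≤ r * |P r| ^ A :=
          mul_le_mul_of_nonneg_right hr.1 (by positivity)
        have t8 : 0 ≤ |P r| ^ A := by positivity
        have t9 : 0 ≤ |w r| ^ B := by positivity
        have e1' := mul_le_mul_of_nonneg_left e1 (by positivity : 0 ≤ t + 1)
        have e2' := mul_le_mul_of_nonneg_left e2 (by positivity : 0 ≤ 2 * n)
        have f1 : (t + 1) * (1 / (16 * (t + 1)) * (|P r| ^ A + |w r| ^ B) + C1) =
            (|P r| ^ A + |w r| ^ B) / 16 + (t + 1) * C1 := by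
          field_simp
        have f2 : 2 * n * (1 / (32 * n) * (|P r| ^ A + |w r| ^ B) + C2) =
            (|P r| ^ A + |w r| ^ B) / 16 + 2 * n * C2 := by
          field_simp; ring
        rw [f1] at e1'
        rw [f2] at e2'
        rw [hF', t1]
        linarith
      · have x1 := rpow_mul_rpow_le_one_add_rpow (a := s + 2) (b := 0) (by positivity) le_rfl hA0
          hB0 (by simpa using g1) (abs_nonneg (P r)) (abs_nonneg (w r))
        have x2 := rpow_mul_rpow_le_one_add_rpow (a := 0) (b := 2) le_rfl (by positivity) hA0
          hB0 (by simpa using g2) (abs_nonneg (P r)) (abs_nonneg (w r))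
        have x3 := rpow_mul_rpow_le_one_add_rpow (a := 0) (b := k + 2) le_rfl (by positivity) hA0
          hB0 (by simpa using g3) (abs_nonneg (P r)) (abs_nonneg (w r))
        have x4 := rpow_mul_rpow_le_one_add_rpow (a := 1) (b := t + 1) zero_le_one (by positivity)
          hA0 hB0 g4 (abs_nonneg (P r)) (abs_nonneg (w r))
        simp only [Real.rpow_zero, one_mul, mul_one] at x1 x2 x3
        have x2' : w r ^ 2 ≤ (1 + (|P r| ^ A + |w r| ^ B)) ^ γ := by
          rw [← sq_abs, ← Real.rpow_two]; exact x2
        have x5 := le_abs_self (|w r| ^ t * w r * P r)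
        rw [hcross] at x5
        have y1 : |P r| ^ (s + 2) / (s + 2) ≤ |P r| ^ (s + 2) :=
          div_le_self (by positivity) (by linarith)
        have y2 : |w r| ^ (k + 2) / (k + 2) ≤ |w r| ^ (k + 2) :=
          div_le_self (by positivity) (by linarith)
        have y3 : α * w r ^ 2 / 2 ≤ A₀ * w r ^ 2 := by nlinarith [sq_nonneg (w r)]
        have y4 := mul_le_mul_of_nonneg_left x2' hA₀
        simp only [radialEnergy]
        linarith)
  have hlow := neg_abs_le (|w 1| ^ t * w 1 * P 1)
  rw [hcross] at hlow
  have h4 := H4 |P 1| |w 1| (abs_nonneg _) (abs_nonneg _)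
  have h5 : 1 / (2 * ((s + 2) * (k + 2))) * (|P 1| ^ (s + 2) + |w 1| ^ (k + 2)) ≤
      radialEnergy s k α w P 1 / 2 := by
    have a1 : |P 1| ^ (s + 2) / (s + 2) / (k + 2) ≤ |P 1| ^ (s + 2) / (s + 2) :=
      div_le_self (by positivity) (by linarith)
    have a2 : |w 1| ^ (k + 2) / (k + 2) / (s + 2) ≤ |w 1| ^ (k + 2) / (k + 2) :=
      div_le_self (by positivity) (by linarith)
    have a3 : 0 ≤ α * w 1 ^ 2 / 2 := by positivity
    have a4 : 1 / (2 * ((s + 2) * (k + 2))) * (|P 1| ^ (s + 2) + |w 1| ^ (k + 2)) =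
        (|P 1| ^ (s + 2) / (s + 2) / (k + 2) + |w 1| ^ (k + 2) / (k + 2) / (s + 2)) / 2 := by
      field_simp
    rw [a4, radialEnergy]
    linarith
  linarith

namespace IsRadialSystem

variable {n s k α : ℝ} {w P : ℝ → ℝ}

theorem neg (h : IsRadialSystem n s k α w P) :
    IsRadialSystem n s k α (fun r => -w r) (fun r => -P r) where
  hasDerivAt_fst r hr := (h.hasDerivAt_fst r hr).neg.congr_deriv (by rw [abs_neg]; ring)
  hasDerivAt_snd r hr := (h.hasDerivAt_snd r hr).neg.congr_deriv (by rw [abs_neg, abs_neg]; ring)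

theorem abs_le_of_one_le (h : IsRadialSystem n s k α w P) (hn : 1 ≤ n) (hs : 0 ≤ s) (hk : 0 ≤ k)
    (hα : 1 ≤ α) {r : ℝ} (hr : 1 ≤ r) :
    |w r| ≤ 1 + 2 * radialEnergy s k α w P 1 ∧
      |P r| ≤ 1 + (s + 2) * radialEnergy s k α w P 1 := by
  have h0 : radialEnergy s k α w P r ≤ radialEnergy s k α w P 1 :=
    h.antitoneOn_radialEnergy hn hs hk (mem_Ioi.2 one_pos) (mem_Ioi.2 (by linarith)) hr
  have h1 : 0 ≤ |P r| ^ (s + 2) / (s + 2) := by positivity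
  have h2 : 0 ≤ |w r| ^ (k + 2) / (k + 2) := by positivity
  have h3 : 0 ≤ α * w r ^ 2 / 2 := by positivity
  have h4 : radialEnergy s k α w P r =
    |P r| ^ (s + 2) / (s + 2) + α * w r ^ 2 / 2 + |w r| ^ (k + 2) / (k + 2) := rfl
  constructor
  · have : w r ^ 2 ≤ 2 * radialEnergy s k α w P 1 := by nlinarith [sq_nonneg (w r)]
    nlinarith [sq_nonneg (|w r| - 1), sq_abs (w r)]
  · have h5 : |P r| ^ (s + 2) ≤ (s + 2) * radialEnergy s k α w P 1 := by
      rw [← div_le_iff₀' (by linarith)]; linarith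
    rcases le_total 1 |P r| with h6 | h6
    · have := Real.self_le_rpow_of_one_le h6 (by linarith : 1 ≤ s + 2)
      linarith
    · have : 0 ≤ |P r| ^ (s + 2) := by positivity
      linarith

/-- Solutions of the radial equation decay at infinity. -/
theorem exists_abs_le_rpow_neg_half (h : IsRadialSystem n s k α w P) (hn : 1 ≤ n) (hs : 0 ≤ s)
    (hk : 0 ≤ k) (hα : 1 ≤ α) :
    ∃ C, 0 < C ∧ ∀ r, 1 ≤ r → |w r| ≤ C * r ^ (-(1 / 2) : ℝ) := by
  set E := radialEnergy s k α w P 1 with hE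
  have hE0 : 0 ≤ E := by rw [hE, radialEnergy]; positivity
  set M := 1 + (s + 2) * E with hM
  have hM0 : 0 < M := by positivity
  set D := (α + (1 + 2 * E) ^ k + n) * M with hD
  have hbound : ∀ r, 1 ≤ r → |(α + |w r| ^ k - n) * P r| ≤ D := by
    intro r hr
    obtain ⟨h1, h2⟩ := h.abs_le_of_one_le hn hs hk hα hr
    rw [abs_mul, hD]
    have h3 : |w r| ^ k ≤ (1 + 2 * E) ^ k := Real.rpow_le_rpow (abs_nonneg _) h1 hk
    have h4 : 0 ≤ |w r| ^ k := by positivity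
    refine mul_le_mul ?_ h2 (abs_nonneg _) (by positivity)
    rw [abs_le]; constructor <;> linarith
  have hanti : AntitoneOn (fun r => r * (w r + P r / r) ^ 2 + D ^ 2 / r) (Ici 1) := by
    refine antitoneOn_of_hasDerivAt_nonpos (f' := fun r => (1 - 2 * (α + |w r| ^ k)) *
      (w r + P r / r) ^ 2 + 2 * (w r + P r / r) * ((α + |w r| ^ k - n) * P r / r)
        - D ^ 2 / r ^ 2) (convex_Ici 1) (fun r hr => ?_) (fun r hr => ?_)
    · have hr0 : 0 < r := lt_of_lt_of_le one_pos hr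
      have d1 := (h.hasDerivAt_fst r hr0).add
        ((h.hasDerivAt_snd r hr0).div (hasDerivAt_id' r) hr0.ne')
      have d2 := ((hasDerivAt_id' r).mul (d1.pow 2)).add
        ((hasDerivAt_const r (D ^ 2)).div (hasDerivAt_id' r) hr0.ne')
      refine d2.congr_deriv ?_
      have hne : r ≠ 0 := hr0.ne'
      simp only [Pi.add_apply, Pi.div_apply, Pi.pow_apply]
      push_cast
      field_simp
      ring
    · have hr0 : 0 < r := lt_of_lt_of_le one_pos hr
      have h1 := hbound r hr
      set u := w r + P r / r
      set B := (α + |w r| ^ k - n) * P r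
      have h4 : 0 ≤ |w r| ^ k := by positivity
      have h5 : (1 - 2 * (α + |w r| ^ k)) * u ^ 2 ≤ - u ^ 2 := by nlinarith [sq_nonneg u]
      have h6 : B ^ 2 ≤ D ^ 2 := sq_le_sq' (abs_le.1 h1).1 (abs_le.1 h1).2
      have h7 : B ^ 2 / r ^ 2 ≤ D ^ 2 / r ^ 2 := by gcongr
      have h8 : 2 * u * (B / r) ≤ u ^ 2 + B ^ 2 / r ^ 2 := by
        have := sq_nonneg (u - B / r)
        rw [← div_pow]; linarith
      linarith
  set G := (w 1 + P 1) ^ 2 + D ^ 2 with hG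
  refine ⟨√G + M, by positivity, fun r hr => ?_⟩
  have hr0 : 0 < r := lt_of_lt_of_le one_pos hr
  have h1 := hanti (mem_Ici.2 le_rfl) hr hr
  simp only [div_one, one_mul] at h1
  have h2 : 0 ≤ D ^ 2 / r := by positivity
  have h3 : (w r + P r / r) ^ 2 ≤ G * (r ^ (-(1 / 2) : ℝ)) ^ 2 := by
    have : (r ^ (-(1 / 2) : ℝ)) ^ 2 = r⁻¹ := by
      rw [← Real.rpow_natCast, ← Real.rpow_mul hr0.le, ← Real.rpow_neg_one]; norm_num
    rw [this, ← div_eq_mul_inv, le_div_iff₀ hr0]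
    linarith
  have h4 : |w r + P r / r| ≤ √G * r ^ (-(1 / 2) : ℝ) := by
    rw [← Real.sqrt_sq (by positivity : 0 ≤ r ^ (-(1 / 2) : ℝ)), ← Real.sqrt_mul (by positivity)]
    exact Real.abs_le_sqrt h3
  have h5 : |P r / r| ≤ M * r ^ (-(1 / 2) : ℝ) := by
    rw [abs_div, abs_of_pos hr0, div_eq_mul_inv]
    have h6 : r⁻¹ ≤ r ^ (-(1 / 2) : ℝ) := by
      rw [← Real.rpow_neg_one]
      exact Real.rpow_le_rpow_of_exponent_le hr (by norm_num)
    exact mul_le_mul (h.abs_le_of_one_le hn hs hk hα hr).2 h6 (by positivity) hM0.le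
  calc |w r| = |(w r + P r / r) - P r / r| := by ring_nf
    _ ≤ |w r + P r / r| + |P r / r| := abs_sub _ _
    _ ≤ _ := by linarith

end IsRadialSystem

/-! ### The equation in logarithmic variables -/

/-- The plane system satisfied by `y(τ) = r^δ w(r)` and `Y(τ) = -r^{δ-1} |w'|^{p-2} w'(r)`,
`τ = log r`. Here `κ = δ - N`, and `b` is the contribution of the source term. -/
structure IsPlaneSystem (s δ κ α : ℝ) (b y Y : ℝ → ℝ) : Prop where
  hasDerivAt_fst : ∀ t, HasDerivAt y (δ * y t - |Y t| ^ s * Y t) t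
  hasDerivAt_snd : ∀ t, HasDerivAt Y (κ * Y t - |Y t| ^ s * Y t + (α + b t) * y t) t

theorem IsPlaneSystem.neg {s δ κ α : ℝ} {b y Y : ℝ → ℝ} (h : IsPlaneSystem s δ κ α b y Y) :
    IsPlaneSystem s δ κ α b (fun t => -y t) (fun t => -Y t) where
  hasDerivAt_fst t := (h.hasDerivAt_fst t).neg.congr_deriv (by rw [abs_neg]; ring)
  hasDerivAt_snd t := (h.hasDerivAt_snd t).neg.congr_deriv (by rw [abs_neg]; ring)

theorem IsRadialSystem.isPlaneSystem {n s k α δ : ℝ} {w P : ℝ → ℝ}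
    (h : IsRadialSystem n s k α w P) (hδ : s * (δ - 1) = 2) :
    IsPlaneSystem s δ (δ - n) α (fun t => |w (Real.exp t)| ^ k)
      (fun t => Real.exp (δ * t) * w (Real.exp t))
      (fun t => -(Real.exp ((δ - 1) * t) * P (Real.exp t))) := by
  have hlin : ∀ c t : ℝ, HasDerivAt (fun t => Real.exp (c * t)) (c * Real.exp (c * t)) t := by
    intro c t
    exact ((hasDerivAt_id' t).const_mul c).exp.congr_deriv (by ring)
  have key : ∀ t, |(-(Real.exp ((δ - 1) * t) * P (Real.exp t)))| ^ s *
      (-(Real.exp ((δ - 1) * t) * P (Real.exp t))) =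
      -(Real.exp (δ * t) * Real.exp t * (|P (Real.exp t)| ^ s * P (Real.exp t))) := by
    intro t
    rw [abs_neg, abs_mul, abs_of_pos (Real.exp_pos _), Real.mul_rpow (Real.exp_pos _).le
      (abs_nonneg _), ← Real.exp_mul]
    have : Real.exp ((δ - 1) * t * s) * Real.exp ((δ - 1) * t) =
        Real.exp (δ * t) * Real.exp t := by
      rw [← Real.exp_add, ← Real.exp_add]
      congr 1
      linear_combination t * hδ
    linear_combination (-(|P (Real.exp t)| ^ s * P (Real.exp t))) * this
  have hexp : ∀ t, Real.exp (δ * t) = Real.exp ((δ - 1) * t) * Real.exp t := by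
    intro t; rw [← Real.exp_add]; congr 1; ring
  refine ⟨fun t => ?_, fun t => ?_⟩
  · have d1 := (h.hasDerivAt_fst _ (Real.exp_pos t)).comp t (Real.hasDerivAt_exp t)
    refine ((hlin δ t).mul d1).congr_deriv ?_
    rw [key]
    simp only [Function.comp]
    ring
  · have d1 := (h.hasDerivAt_snd _ (Real.exp_pos t)).comp t (Real.hasDerivAt_exp t)
    refine ((hlin (δ - 1) t).mul d1).neg.congr_deriv ?_
    rw [key]
    simp only [Function.comp]
    rw [hexp]
    have := (Real.exp_pos t).ne'
    field_simp
    ring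

/-- A smooth bounded substitute for the sign function. -/
theorem exists_smooth_sign : ∃ g g' : ℝ → ℝ, ∀ z, HasDerivAt g (g' z) z ∧ |g z| ≤ 1 ∧
    |g' z| ≤ 1 ∧ |z * g' z| ≤ 1 ∧ |z| - 1 ≤ z * g z ∧ 0 ≤ z * g z := by
  refine ⟨fun z => z / √(1 + z ^ 2), fun z => 1 / √(1 + z ^ 2) ^ 3, fun z => ?_⟩
  set q := √(1 + z ^ 2) with hq
  have hp : 0 < 1 + z ^ 2 := by positivity
  have hq2 : q ^ 2 = 1 + z ^ 2 := Real.sq_sqrt hp.le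
  have hq1 : 1 ≤ q := by rw [hq]; exact Real.one_le_sqrt.2 (by nlinarith [sq_nonneg z])
  have hzq : |z| ≤ q := Real.abs_le_sqrt (by linarith)
  have hqz : q ≤ 1 + |z| := by
    rw [hq, Real.sqrt_le_left (by positivity)]
    nlinarith [sq_abs z, abs_nonneg z]
  have hq0 : 0 < q := by linarith
  have hq3 : 1 ≤ q ^ 3 := one_le_pow₀ hq1
  refine ⟨?_, ?_, ?_, ?_, ?_, ?_⟩
  · have h1 : HasDerivAt (fun z : ℝ => 1 + z ^ 2) (2 * z) z :=
      (((hasDerivAt_id' z).pow 2).const_add 1).congr_deriv (by simp)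
    refine ((hasDerivAt_id' z).div (h1.sqrt hp.ne') hq0.ne').congr_deriv ?_
    simp only [← hq]
    field_simp
    linear_combination hq2
  · rw [abs_div, abs_of_pos hq0, div_le_one hq0]; exact hzq
  · rw [abs_of_pos (by positivity), div_le_one (by positivity)]; exact hq3
  · rw [abs_mul, abs_of_pos (by positivity : 0 < 1 / q ^ 3), mul_one_div,
      div_le_one (by positivity)]
    nlinarith
  · rw [mul_div_assoc', le_div_iff₀ hq0]
    nlinarith [sq_abs z, abs_nonneg z]
  · rw [mul_div_assoc']; exact div_nonneg (mul_self_nonneg z) hq0.le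

theorem exists_abs_rpow_le_mul_add {s a η : ℝ} (ha0 : 0 ≤ a) (ha : a < s + 2) (hη : 0 < η) :
    ∃ C, 0 ≤ C ∧ ∀ x : ℝ, |x| ^ a ≤ η * |x| ^ (s + 2) + C := by
  have hs2 : 0 < s + 2 := by linarith
  obtain ⟨C, hC, H⟩ := exists_rpow_le_mul_add (γ := a / (s + 2)) (η := η) (by positivity)
    ((div_lt_one hs2).2 ha) hη
  refine ⟨C, hC, fun x => ?_⟩
  have h := H (|x| ^ (s + 2)) (by positivity)
  rwa [← Real.rpow_mul (abs_nonneg x), mul_div_cancel₀ _ hs2.ne'] at h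

theorem exists_quadratic_le_superquadratic {s κ c₁ c₂ : ℝ} (hs : 0 < s) (hκ : 0 < κ)
    (h₁ : 0 < c₁) (h₂ : 0 < c₂) :
    ∃ C, 0 ≤ C ∧ ∀ x : ℝ, c₂ * x ^ 2 + c₁ * |x| + |x| ^ (s + 1) ≤ κ * |x| ^ (s + 2) + C := by
  obtain ⟨C2, hC2, H2⟩ := exists_abs_rpow_le_mul_add (s := s) (a := 2) (η := κ / (4 * c₂))
    (by norm_num) (by linarith) (by positivity)
  obtain ⟨C1, hC1, H1⟩ := exists_abs_rpow_le_mul_add (s := s) (a := 1) (η := κ / (4 * c₁))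
    (by norm_num) (by linarith) (by positivity)
  obtain ⟨C3, hC3, H3⟩ := exists_abs_rpow_le_mul_add (s := s) (a := s + 1) (η := κ / 4)
    (by linarith) (by linarith) (by positivity)
  refine ⟨c₂ * C2 + c₁ * C1 + C3, by positivity, fun x => ?_⟩
  have e2 := mul_le_mul_of_nonneg_left (H2 x) h₂.le
  have e1 := mul_le_mul_of_nonneg_left (H1 x) h₁.le
  have e3 := H3 x
  rw [Real.rpow_two, sq_abs] at e2
  rw [Real.rpow_one] at e1
  have f2 : c₂ * (κ / (4 * c₂) * |x| ^ (s + 2) + C2) = κ / 4 * |x| ^ (s + 2) + c₂ * C2 := by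
    field_simp
  have f1 : c₁ * (κ / (4 * c₁) * |x| ^ (s + 2) + C1) = κ / 4 * |x| ^ (s + 2) + c₁ * C1 := by
    field_simp
  have : 0 ≤ κ * |x| ^ (s + 2) := by positivity
  linarith

/-- The differential inequality behind the Lyapunov function of the plane system. -/
theorem lyapunov_deriv_le {κ α θ δ B b z Y Φ g g' : ℝ} (hκ : 0 < κ) (hα1 : 1 ≤ α) (hαδ : α ≤ δ)
    (hθ0 : 0 ≤ θ) (hθ1 : θ ≤ 1) (hb0 : 0 ≤ b) (hbB : b ≤ B) (hg : |g| ≤ 1) (hg' : |g'| ≤ 1)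
    (hzg' : |z * g'| ≤ 1) (hzg : |z| - 1 ≤ z * g) (hzg0 : 0 ≤ z * g) :
    α * z * ((θ - b) * (z + Y) - κ * Y) + κ * Y * (κ * Y - Φ + (α + b) * (z + Y))
      - (g' * ((θ - b) * (z + Y) - κ * Y) * Y + g * (κ * Y - Φ + (α + b) * (z + Y))) ≤
    2 * δ * θ * z ^ 2 + (δ + B * ((κ + δ) ^ 2 + κ) + κ * (κ + δ) + (1 + B) + κ) * Y ^ 2
      + (κ + (δ + B) + (1 + B)) * |Y| + |Φ| - κ * (Φ * Y) + 1 - |z| := by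
  have hδ : 1 ≤ δ := hα1.trans hαδ
  have hB : 0 ≤ B := hb0.trans hbB
  have hY := abs_nonneg Y
  have hYY := sq_abs Y
  have k1 : α * θ * (z ^ 2 + z * Y) ≤ δ * θ * (2 * z ^ 2 + Y ^ 2) := by
    have a1 : z ^ 2 + z * Y ≤ 2 * z ^ 2 + Y ^ 2 := by nlinarith [sq_nonneg (z - Y)]
    have a2 : α * θ ≤ δ * θ := mul_le_mul_of_nonneg_right hαδ hθ0
    calc α * θ * (z ^ 2 + z * Y) ≤ α * θ * (2 * z ^ 2 + Y ^ 2) :=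
          mul_le_mul_of_nonneg_left a1 (by positivity)
      _ ≤ _ := mul_le_mul_of_nonneg_right a2 (by positivity)
  have k1' : δ * θ * Y ^ 2 ≤ δ * Y ^ 2 := by
    nlinarith [mul_nonneg (by linarith : 0 ≤ δ) (sq_nonneg Y)]
  have k2 : b * (-(α * z ^ 2) + (κ - α) * (z * Y) + κ * Y ^ 2) ≤
      B * ((κ + δ) ^ 2 + κ) * Y ^ 2 := by
    have a1 : -(α * z ^ 2) + (κ - α) * (z * Y) ≤ (κ + δ) ^ 2 * Y ^ 2 := by
      have e1 : (κ - α) * (z * Y) ≤ z ^ 2 + (κ - α) ^ 2 * Y ^ 2 := by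
        nlinarith [sq_nonneg (z - (κ - α) * Y), sq_nonneg (z + (κ - α) * Y)]
      have e2 : (κ - α) ^ 2 ≤ (κ + δ) ^ 2 := by
        apply sq_le_sq' <;> linarith
      have e3 := mul_le_mul_of_nonneg_right e2 (sq_nonneg Y)
      have e4 : z ^ 2 ≤ α * z ^ 2 := le_mul_of_one_le_left (sq_nonneg z) hα1
      linarith
    calc b * (-(α * z ^ 2) + (κ - α) * (z * Y) + κ * Y ^ 2)
        ≤ b * (((κ + δ) ^ 2 + κ) * Y ^ 2) := mul_le_mul_of_nonneg_left (by linarith) hb0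
      _ ≤ B * (((κ + δ) ^ 2 + κ) * Y ^ 2) := mul_le_mul_of_nonneg_right hbB (by positivity)
      _ = _ := by ring
  have k3 : κ * (κ + α) * Y ^ 2 ≤ κ * (κ + δ) * Y ^ 2 := by gcongr
  have hθb : |θ - b| ≤ 1 + B := by rw [abs_le]; constructor <;> linarith
  have k4 : -(g' * ((θ - b) * (z + Y) - κ * Y) * Y) ≤ (1 + B) * (|Y| + Y ^ 2) + κ * Y ^ 2 := by
    have a1 : -((θ - b) * ((z * g') * Y)) ≤ (1 + B) * |Y| := by
      refine (neg_le_abs _).trans ?_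
      rw [abs_mul, abs_mul]
      exact mul_le_mul hθb (mul_le_of_le_one_left hY hzg') (by positivity) (by positivity)
    have a2 : -((θ - b) * (g' * Y ^ 2)) ≤ (1 + B) * Y ^ 2 := by
      refine (neg_le_abs _).trans ?_
      rw [abs_mul, abs_mul, abs_of_nonneg (sq_nonneg Y)]
      exact mul_le_mul hθb (mul_le_of_le_one_left (sq_nonneg Y) hg') (by positivity)
        (by positivity)
    have a3 : κ * (g' * Y ^ 2) ≤ κ * Y ^ 2 := by
      gcongr
      exact mul_le_of_le_one_left (sq_nonneg Y) ((le_abs_self _).trans hg')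
    linarith
  have k5 : -(g * (κ * Y)) ≤ κ * |Y| := by
    refine (neg_le_abs _).trans ?_
    rw [abs_mul, abs_mul, abs_of_pos hκ]
    exact mul_le_of_le_one_left (by positivity) hg
  have k6 : g * Φ ≤ |Φ| := by
    refine (le_abs_self _).trans ?_
    rw [abs_mul]
    exact mul_le_of_le_one_left (abs_nonneg _) hg
  have k7 : -((α + b) * (z * g)) ≤ 1 - |z| := by nlinarith
  have k8 : -((α + b) * (g * Y)) ≤ (δ + B) * |Y| := by
    refine (neg_le_abs _).trans ?_
    rw [abs_mul, abs_mul, abs_of_nonneg (by linarith : 0 ≤ α + b)]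
    exact mul_le_mul (by linarith) (mul_le_of_le_one_left hY hg) (by positivity) (by positivity)
  linarith

theorem abs_le_one_add_of_sq_le {x q : ℝ} (h : x ^ 2 ≤ q) : |x| ≤ 1 + q := by
  nlinarith [sq_nonneg (|x| - 1), sq_abs x]

/-- Solutions of the plane system are bounded for positive times, uniformly with respect to
`α` close to `δ`. -/
theorem exists_uniform_bound_isPlaneSystem {s δ κ B R : ℝ} (hs : 0 < s) (hδ : 0 < δ) (hκ : 0 < κ)
    (hB : 0 ≤ B) (hR : 0 ≤ R) :
    ∃ θ₀ Z, 0 < θ₀ ∧ ∀ α b y Y, 1 ≤ α → α ≤ δ → δ - α < θ₀ → IsPlaneSystem s δ κ α b y Y →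
      (∀ t, 0 ≤ t → 0 ≤ b t ∧ b t ≤ B) → |y 0| ≤ R → |Y 0| ≤ R →
      ∀ t, 0 ≤ t → |y t - Y t| ≤ Z ∧ |Y t| ≤ Z := by
  obtain ⟨g, g', hgg⟩ := exists_smooth_sign
  obtain ⟨C, hC, HC⟩ := exists_quadratic_le_superquadratic (s := s) (κ := κ)
    (c₁ := (κ + (δ + B) + (1 + B)) + 1)
    (c₂ := δ + B * ((κ + δ) ^ 2 + κ) + κ * (κ + δ) + (1 + B) + κ) hs hκ (by positivity)
    (by positivity)
  set L := C + 3 + 3 * R with hL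
  have hL0 : 0 < L := by positivity
  set K := (δ + κ) * L ^ 2 + L + 1 with hK
  have hK0 : 0 < K := by positivity
  set Z1 := 2 * K + 1 / κ with hZ1
  have hZ10 : 0 < Z1 := by positivity
  refine ⟨min 1 (1 / (2 * δ * Z1)), 1 + Z1 + 4 * (K + 1 / κ) / κ, by positivity,
    fun α b y Y hα1 hαδ hθ h hb hy0 hY0 => ?_⟩
  set θ := δ - α with hθdef
  have hθ0 : 0 ≤ θ := by linarith
  have hθ1 : θ ≤ 1 := (hθ.le.trans (min_le_left _ _))
  have hθZ : 2 * δ * θ * Z1 < 2 := by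
    have := hθ.trans_le (min_le_right _ _)
    rw [lt_div_iff₀ (by positivity)] at this
    linarith
  obtain ⟨W, hW⟩ : ∃ W : ℝ → ℝ, W = fun t => (α * (y t - Y t) ^ 2 + κ * Y t ^ 2) / 2
      - g (y t - Y t) * Y t := ⟨_, rfl⟩
  have hgY : ∀ t, |g (y t - Y t) * Y t| ≤ |Y t| := fun t => by
    rw [abs_mul]; exact mul_le_of_le_one_left (abs_nonneg _) (hgg _).2.1
  have hWder : ∀ t, HasDerivAt W
      (α * (y t - Y t) * ((θ - b t) * ((y t - Y t) + Y t) - κ * Y t)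
      + κ * Y t * (κ * Y t - |Y t| ^ s * Y t + (α + b t) * ((y t - Y t) + Y t))
      - (g' (y t - Y t) * ((θ - b t) * ((y t - Y t) + Y t) - κ * Y t) * Y t
        + g (y t - Y t) * (κ * Y t - |Y t| ^ s * Y t + (α + b t) * ((y t - Y t) + Y t)))) t := by
    intro t
    have dz := (h.hasDerivAt_fst t).sub (h.hasDerivAt_snd t)
    have dY := h.hasDerivAt_snd t
    have dg := (hgg (y t - Y t)).1.comp t dz
    have d := ((((dz.pow 2).const_mul α).add ((dY.pow 2).const_mul κ)).div_const 2).sub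
      (dg.mul dY)
    rw [hW]
    refine d.congr_deriv ?_
    simp only [Function.comp, Pi.sub_apply, hθdef]
    push_cast
    ring
  have hWup : ∀ t, |y t - Y t| + |Y t| ≤ L → W t < K := by
    intro t ht
    have a1 := neg_abs_le (g (y t - Y t) * Y t)
    have a2 := hgY t
    have a3 : (y t - Y t) ^ 2 ≤ L ^ 2 := by
      rw [← sq_abs]; gcongr; linarith [abs_nonneg (Y t)]
    have a4 : Y t ^ 2 ≤ L ^ 2 := by
      rw [← sq_abs]; gcongr; linarith [abs_nonneg (y t - Y t)]
    have a5 : α * (y t - Y t) ^ 2 ≤ δ * L ^ 2 := mul_le_mul hαδ a3 (sq_nonneg _) hδ.le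
    have a6 : κ * Y t ^ 2 ≤ κ * L ^ 2 := by gcongr
    have a7 : 0 ≤ δ * L ^ 2 := by positivity
    have a8 : 0 ≤ κ * L ^ 2 := by positivity
    rw [hW]
    simp only
    linarith [abs_nonneg (y t - Y t)]
  have hWlow : ∀ t, W t ≤ K → (y t - Y t) ^ 2 ≤ Z1 ∧ Y t ^ 2 ≤ 4 * (K + 1 / κ) / κ := by
    intro t ht
    have a1 := le_abs_self (g (y t - Y t) * Y t)
    have a2 := hgY t
    have a3 : -(1 / κ) ≤ κ * Y t ^ 2 / 4 - |Y t| := by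
      have : κ * Y t ^ 2 / 4 - |Y t| = (κ * |Y t| / 2 - 1) ^ 2 / κ - 1 / κ := by
        rw [← sq_abs]; field_simp; ring
      rw [this]
      have : 0 ≤ (κ * |Y t| / 2 - 1) ^ 2 / κ := by positivity
      linarith
    have a3' : -(1 / (2 * κ)) ≤ κ * Y t ^ 2 / 2 - |Y t| := by
      have : κ * Y t ^ 2 / 2 - |Y t| = (κ * |Y t| - 1) ^ 2 / (2 * κ) - 1 / (2 * κ) := by
        rw [← sq_abs]; field_simp; ring
      rw [this]
      have : 0 ≤ (κ * |Y t| - 1) ^ 2 / (2 * κ) := by positivity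
      linarith
    have a4 : (y t - Y t) ^ 2 ≤ α * (y t - Y t) ^ 2 :=
      le_mul_of_one_le_left (sq_nonneg _) hα1
    have a5 : 1 / (2 * κ) = 1 / κ / 2 := by field_simp
    rw [hW] at ht
    simp only at ht
    constructor
    · rw [hZ1]; linarith
    · rw [le_div_iff₀ hκ]
      linarith [sq_nonneg (y t - Y t)]
  intro t ht
  have hWt : W t ≤ K := by
    refine le_of_hasDerivAt_neg_on_level ht (fun x _ => hWder x) (hWup 0 ?_).le (fun x hx hxK => ?_)
    · have := abs_sub (y 0) (Y 0)
      rw [hL]; linarith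
    · obtain ⟨-, c1, c2, c3, c4, c5⟩ := hgg (y x - Y x)
      have e1 := lyapunov_deriv_le (Y := Y x) (Φ := |Y x| ^ s * Y x) hκ hα1 hαδ hθ0 hθ1
        (hb x hx.1).1 (hb x hx.1).2 c1 c2 c3 c4 c5
      have e2 := HC (Y x)
      have e3 : |(|Y x| ^ s * Y x)| = |Y x| ^ (s + 1) := by
        rw [abs_mul, abs_of_nonneg (by positivity : 0 ≤ |Y x| ^ s), abs_rpow_mul_abs hs.le]
      have e4 : |Y x| ^ s * Y x * Y x = |Y x| ^ (s + 2) := by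
        rw [← abs_rpow_mul_sq hs.le]; ring
      have e5 : L < |y x - Y x| + |Y x| := by
        by_contra hcon
        exact absurd hxK (hWup x (not_lt.1 hcon)).ne
      have e6 : 2 * δ * θ * (y x - Y x) ^ 2 ≤ 2 * δ * θ * Z1 :=
        mul_le_mul_of_nonneg_left (hWlow x hxK.le).1 (by positivity)
      rw [e3, e4] at e1
      linarith
  obtain ⟨h1, h2⟩ := hWlow t hWt
  have e1 := abs_le_one_add_of_sq_le h1
  have e2 := abs_le_one_add_of_sq_le h2
  have e3 : 0 ≤ 4 * (K + 1 / κ) / κ := by positivity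
  exact ⟨by linarith, by linarith⟩

theorem tendsto_exp_neg_mul_of_bounded {l M T : ℝ} {f : ℝ → ℝ} (hl : 0 < l)
    (hf : ∀ t, T ≤ t → |f t| ≤ M) : Tendsto (fun t => Real.exp (-l * t) * f t) atTop (𝓝 0) := by
  have h1 : Tendsto (fun t : ℝ => Real.exp (-l * t)) atTop (𝓝 0) :=
    Real.tendsto_exp_atBot.comp (tendsto_id.const_mul_atTop_of_neg (by linarith))
  have h2 : Tendsto (fun t : ℝ => Real.exp (-l * t) * M) atTop (𝓝 0) := by
    simpa using h1.mul_const M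
  refine squeeze_zero_norm' ?_ h2
  filter_upwards [eventually_ge_atTop T] with t ht
  rw [Real.norm_eq_abs, abs_mul, abs_of_pos (Real.exp_pos _)]
  exact mul_le_mul_of_nonneg_left (hf t ht) (Real.exp_pos _).le

theorem hasDerivAt_exp_neg_mul {l f' t : ℝ} {f : ℝ → ℝ} (hf : HasDerivAt f f' t) :
    HasDerivAt (fun t => Real.exp (-l * t) * f t) (Real.exp (-l * t) * (f' - l * f t)) t :=
  (((hasDerivAt_id' t).const_mul (-l)).exp.mul hf).congr_deriv (by ring)

/-- A bounded solution of the plane system with `α` close to `δ` is not eventually positive. -/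
theorem IsPlaneSystem.not_eventually_pos_of_bounded {s δ κ α : ℝ} {b y Y : ℝ → ℝ}
    (h : IsPlaneSystem s δ κ α b y Y) (hs : 0 < s) (hδ : 0 < δ) (hκ : 0 < κ) (hα : 0 < α)
    (hακ : δ - κ ≤ α) (hαδ : α ≤ δ) (hb : ∀ t, 0 ≤ b t) {Z T : ℝ}
    (hZ : ∀ t, 0 ≤ t → |y t - Y t| ≤ Z ∧ |Y t| ≤ Z)
    (hθ : (δ - α) * (2 * Z) ≤ κ * κ ^ (1 / s) / 2) (hpos : ∀ t, T ≤ t → 0 < y t) : False := by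
  set T₀ := max T 0 with hT₀
  have hTT : T ≤ T₀ := le_max_left _ _
  have h0T : 0 ≤ T₀ := le_max_right _ _
  have hz : ∀ t, T₀ ≤ t → Y t ≤ y t := by
    have hanti : AntitoneOn (fun t => Real.exp (-κ * t) * (y t - Y t)) (Ici T₀) := by
      refine antitoneOn_of_hasDerivAt_nonpos (convex_Ici _) (fun t _ => hasDerivAt_exp_neg_mul
        ((h.hasDerivAt_fst t).sub (h.hasDerivAt_snd t))) (fun t ht => ?_)
      have hy := hpos t (hTT.trans ht)
      refine mul_nonpos_of_nonneg_of_nonpos (Real.exp_pos _).le ?_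
      nlinarith [mul_nonneg (hb t) hy.le]
    have hlim := tendsto_exp_neg_mul_of_bounded (f := fun t => y t - Y t) hκ
      (fun t ht => (hZ t (h0T.trans ht)).1)
    intro t ht
    have h1 : 0 ≤ Real.exp (-κ * t) * (y t - Y t) := by
      refine le_of_tendsto hlim ?_
      filter_upwards [eventually_ge_atTop t] with u hu
      exact hanti ht (ht.trans hu) hu
    have := nonneg_of_mul_nonneg_right h1 (Real.exp_pos _)
    linarith
  have hyZ : ∀ t, T₀ ≤ t → |y t| ≤ 2 * Z := by
    intro t ht
    obtain ⟨h1, h2⟩ := hZ t (h0T.trans ht)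
    calc |y t| = |(y t - Y t) + Y t| := by ring_nf
      _ ≤ _ := abs_add_le _ _
      _ ≤ 2 * Z := by linarith
  obtain ⟨T₁, hT₁, hY₁⟩ : ∃ T₁, T₀ ≤ T₁ ∧ 0 < Y T₁ := by
    by_contra! hcon
    have hmono : MonotoneOn (fun t => Real.exp (-δ * t) * y t) (Ici T₀) := by
      refine monotoneOn_of_hasDerivAt_nonneg (convex_Ici _) (fun t _ => hasDerivAt_exp_neg_mul
        (h.hasDerivAt_fst t)) (fun t ht => mul_nonneg (Real.exp_pos _).le ?_)
      have h1 := mul_nonneg (by positivity : 0 ≤ |Y t| ^ s) (neg_nonneg.2 (hcon t ht))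
      linarith
    have hlim := tendsto_exp_neg_mul_of_bounded hδ hyZ
    have h1 : Real.exp (-δ * T₀) * y T₀ ≤ 0 := by
      refine ge_of_tendsto hlim ?_
      filter_upwards [eventually_ge_atTop T₀] with u hu
      exact hmono (mem_Ici.2 le_rfl) hu hu
    have := mul_pos (Real.exp_pos (-δ * T₀)) (hpos T₀ hTT)
    linarith
  set Y₀ := κ ^ (1 / s) with hY₀
  have hY₀pos : 0 < Y₀ := by positivity
  have hY₀s : Y₀ ^ s = κ := by
    rw [hY₀, ← Real.rpow_mul hκ.le, one_div_mul_cancel hs.ne', Real.rpow_one]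
  have hgrow : ∀ t, T₀ ≤ t → 0 < Y t → Y t ≤ Y₀ →
      α * Y t ≤ κ * Y t - |Y t| ^ s * Y t + (α + b t) * y t := by
    intro t ht h0 h1
    have h2 : |Y t| ^ s ≤ κ := by
      rw [abs_of_pos h0, ← hY₀s]; exact Real.rpow_le_rpow h0.le h1 hs.le
    have h3 := mul_le_mul_of_nonneg_right h2 h0.le
    have h4 := mul_nonneg (hb t) (h0.le.trans (hz t ht))
    have h5 := mul_le_mul_of_nonneg_left (hz t ht) hα.le
    linarith
  have hbar : ∀ u t μ, T₀ ≤ u → u ≤ t → 0 < μ → μ ≤ Y₀ → μ ≤ Y u → μ ≤ Y t := by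
    intro u t μ hu hut hμ hμY hμu
    refine ge_of_hasDerivAt_pos_on_level hut (fun x _ => h.hasDerivAt_snd x) hμu
      (fun x hx hxμ => ?_)
    have := hgrow x (hu.trans hx.1) (hxμ ▸ hμ) (hxμ ▸ hμY)
    have h2 : 0 < α * Y x := mul_pos hα (hxμ ▸ hμ)
    linarith
  obtain ⟨T₂, hT₂, hY₂⟩ : ∃ T₂, T₁ ≤ T₂ ∧ Y₀ ≤ Y T₂ := by
    by_contra! hcon
    have hYpos : ∀ t, T₁ ≤ t → 0 < Y t := fun t ht =>
      (lt_min hY₁ hY₀pos).trans_le (hbar T₁ t _ hT₁ ht (lt_min hY₁ hY₀pos) (min_le_right _ _)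
        (min_le_left _ _))
    have hmono : MonotoneOn (fun t => Real.exp (-α * t) * Y t) (Ici T₁) := by
      refine monotoneOn_of_hasDerivAt_nonneg (convex_Ici _) (fun t _ => hasDerivAt_exp_neg_mul
        (h.hasDerivAt_snd t)) (fun t ht => mul_nonneg (Real.exp_pos _).le ?_)
      have := hgrow t (hT₁.trans ht) (hYpos t ht) (hcon t ht).le
      linarith
    have hlim := tendsto_exp_neg_mul_of_bounded hα (fun t ht => (hZ t (h0T.trans ht)).2)
    have h1 : Real.exp (-α * T₁) * Y T₁ ≤ 0 := by
      refine ge_of_tendsto hlim ?_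
      filter_upwards [eventually_ge_atTop T₁] with u hu
      exact hmono (mem_Ici.2 le_rfl) hu hu
    have := mul_pos (Real.exp_pos (-α * T₁)) hY₁
    linarith
  set c := κ * Y₀ / 2 with hc
  have hc0 : 0 < c := by positivity
  have hanti : AntitoneOn (fun t => (y t - Y t) + c * t) (Ici T₂) := by
    refine antitoneOn_of_hasDerivAt_nonpos (convex_Ici _)
      (fun t _ => ((h.hasDerivAt_fst t).sub (h.hasDerivAt_snd t)).add
        ((hasDerivAt_id' t).const_mul c)) (fun t ht => ?_)
    have ht0 : T₀ ≤ t := hT₁.trans (hT₂.trans ht)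
    have h1 := hbar T₂ t Y₀ (hT₁.trans hT₂) ht hY₀pos le_rfl hY₂
    have h2 := mul_nonneg (hb t) (hpos t (hTT.trans ht0)).le
    have h3 := mul_le_mul_of_nonneg_left ((le_abs_self _).trans (hyZ t ht0)) (sub_nonneg.2 hαδ)
    have h4 := mul_le_mul_of_nonneg_left h1 hκ.le
    linarith
  have hzT := hz T₂ (hT₁.trans hT₂)
  have h1 : T₂ ≤ T₂ + (y T₂ - Y T₂ + 1) / c := by
    have : 0 ≤ (y T₂ - Y T₂ + 1) / c := div_nonneg (by linarith) hc0.le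
    linarith
  have h2 := hanti (mem_Ici.2 le_rfl) (mem_Ici.2 h1) h1
  have h3 := hz _ ((hT₁.trans hT₂).trans h1)
  simp only at h2
  have h4 : c * ((y T₂ - Y T₂ + 1) / c) = y T₂ - Y T₂ + 1 := by field_simp
  rw [mul_add, h4] at h2
  linarith

/-- A bounded monotone quantity cannot dissipate a fixed amount infinitely often. -/
theorem not_frequently_le_of_dissipation {K K' V V' : ℝ → ℝ} {T ε L M v : ℝ} (hε : 0 < ε)
    (hL : 0 < L) (hv : 0 < v) (hK : ∀ t, T ≤ t → HasDerivAt K (K' t) t)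
    (hV : ∀ t, T ≤ t → HasDerivAt V (V' t) t) (hV0 : ∀ t, 0 ≤ V t)
    (hKV : ∀ t, T ≤ t → ε * V t ≤ K' t) (hVL : ∀ t, T ≤ t → -L ≤ V' t)
    (hM : ∀ t, T ≤ t → K t ≤ M) : ¬ ∃ᶠ t in atTop, v ≤ V t := by
  intro hfreq
  have hmono : MonotoneOn K (Ici T) := monotoneOn_of_hasDerivAt_nonneg (convex_Ici _)
    hK (fun t ht => (mul_nonneg hε.le (hV0 t)).trans (hKV t ht))
  have hgain : ∀ u, T ≤ u → v ≤ V u → K u + ε * (v / 2) * (v / (2 * L)) ≤ K (u + v / (2 * L)) := by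
    intro u hu hvu
    have hstep : 0 < v / (2 * L) := by positivity
    have hVmono : MonotoneOn (fun t => V t + L * t) (Ici u) :=
      monotoneOn_of_hasDerivAt_nonneg (convex_Ici _)
        (fun t ht => (hV t (hu.trans ht)).add ((hasDerivAt_id' t).const_mul L))
        (fun t ht => by have := hVL t (hu.trans ht); linarith)
    have hKmono : MonotoneOn (fun t => K t - ε * (v / 2) * t) (Icc u (u + v / (2 * L))) := by
      refine monotoneOn_of_hasDerivAt_nonneg (convex_Icc _ _)
        (fun t ht => (hK t (hu.trans ht.1)).sub ((hasDerivAt_id' t).const_mul _))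
        (fun t ht => ?_)
      have h1 := hVmono (mem_Ici.2 le_rfl) (mem_Ici.2 ht.1) ht.1
      have h2 := mul_le_mul_of_nonneg_left (sub_le_iff_le_add'.2 ht.2) hL.le
      have h3 : L * (v / (2 * L)) = v / 2 := by field_simp
      have h4 := hKV t (hu.trans ht.1)
      have h5 : v / 2 ≤ V t := by simp only at h1; linarith
      have h6 := mul_le_mul_of_nonneg_left h5 hε.le
      linarith
    have := hKmono ⟨le_rfl, by linarith⟩ ⟨by linarith, le_rfl⟩ (by linarith)
    simp only at this
    linarith
  have hbdd : BddAbove (K '' Ici T) := ⟨M, by rintro _ ⟨t, ht, rfl⟩; exact hM t ht⟩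
  have hne : (K '' Ici T).Nonempty := ⟨K T, T, mem_Ici.2 le_rfl, rfl⟩
  have hpos : 0 < ε * (v / 2) * (v / (2 * L)) := by positivity
  obtain ⟨_, ⟨t, ht, rfl⟩, htS⟩ := exists_lt_of_lt_csSup hne
    (sub_lt_self (sSup (K '' Ici T)) hpos)
  obtain ⟨u, htu, hvu⟩ := (frequently_atTop.1 hfreq) t
  have hu : T ≤ u := (mem_Ici.1 ht).trans htu
  have h1 := hmono ht hu htu
  have h2 := hgain u hu hvu
  have h3 : K (u + v / (2 * L)) ≤ sSup (K '' Ici T) :=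
    le_csSup hbdd ⟨_, mem_Ici.2 (hu.trans (by have : 0 < v / (2 * L) := by positivity
                                              linarith)), rfl⟩
  linarith

namespace IsPlaneSystem

variable {s δ κ α : ℝ} {b y Y : ℝ → ℝ}

theorem continuous_fst (h : IsPlaneSystem s δ κ α b y Y) : Continuous y :=
  continuous_iff_continuousAt.2 fun t => (h.hasDerivAt_fst t).continuousAt

theorem continuous_snd (h : IsPlaneSystem s δ κ α b y Y) : Continuous Y :=
  continuous_iff_continuousAt.2 fun t => (h.hasDerivAt_snd t).continuousAt

/-- Backward uniqueness for the zero solution. -/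
theorem fst_eq_zero_of_le (h : IsPlaneSystem s δ κ α b y Y) (hs : 0 ≤ s) (hδ : 0 ≤ δ)
    (hκ : 0 ≤ κ) (hα : 0 ≤ α) (hb : ∀ t, 0 ≤ b t) (hbc : Continuous b) {t₀ t₁ : ℝ}
    (hy : y t₀ = 0) (hY : Y t₀ = 0) (ht : t₁ ≤ t₀) : y t₁ = 0 := by
  have hc : Continuous fun t => 3 * |Y t| ^ s + α + b t :=
    (((continuous_const.mul ((continuous_abs_rpow hs).comp h.continuous_snd)).add
      continuous_const).add hbc)
  obtain ⟨L, hL⟩ := (isCompact_Icc (a := t₁) (b := t₀)).bddAbove_image hc.continuousOn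
  have hL' : ∀ t ∈ Icc t₁ t₀, 3 * |Y t| ^ s + α + b t ≤ L :=
    fun t ht => hL (mem_image_of_mem _ ht)
  have hmono : MonotoneOn (fun t => Real.exp (-(-L) * t) * (y t ^ 2 + Y t ^ 2)) (Icc t₁ t₀) := by
    refine monotoneOn_of_hasDerivAt_nonneg (convex_Icc _ _) (fun t _ => hasDerivAt_exp_neg_mul
      (((h.hasDerivAt_fst t).pow 2).add ((h.hasDerivAt_snd t).pow 2))) (fun t ht => ?_)
    refine mul_nonneg (Real.exp_pos _).le ?_
    have hX : 0 ≤ |Y t| ^ s := by positivity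
    have h1 := mul_le_mul_of_nonneg_right (hL' t ht)
      (by positivity : 0 ≤ y t ^ 2 + Y t ^ 2)
    have h2 := mul_nonneg hδ (sq_nonneg (y t))
    have h3 := mul_nonneg hκ (sq_nonneg (Y t))
    have h4 := mul_nonneg hX (sq_nonneg (y t - Y t))
    have h5 := mul_nonneg (add_nonneg hα (hb t)) (sq_nonneg (y t + Y t))
    have h6 := mul_nonneg hX (sq_nonneg (y t))
    push_cast
    simp only [pow_one]
    nlinarith
  have := hmono ⟨le_rfl, ht⟩ ⟨ht, le_rfl⟩ ht
  simp only [hy, hY] at this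
  have h1 : y t₁ ^ 2 + Y t₁ ^ 2 ≤ 0 := by
    have hp := Real.exp_pos (-(-L) * t₁)
    by_contra! hcon
    have := mul_pos hp hcon
    norm_num at *
    linarith
  have h2 : y t₁ ^ 2 = 0 := le_antisymm (by nlinarith [sq_nonneg (Y t₁)]) (sq_nonneg _)
  exact pow_eq_zero_iff two_ne_zero |>.1 h2

/-- A forward invariant sector in which `y` stays positive. -/
theorem sector_invariant (h : IsPlaneSystem s δ κ α b y Y) (hs : 0 < s) {m η A T : ℝ}
    (hm : 0 < m) (hm1 : m ≤ 1) (hη : 0 < η) (hmη : m * (m * η) ^ s < δ)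
    (hA : A < m * (δ - κ) + (1 - m) * m * (m * η) ^ s) (hbA : ∀ t, T ≤ t → α + b t ≤ A)
    {t₀ t₁ : ℝ} (ht₀ : T ≤ t₀) (ht : t₀ ≤ t₁) (h0 : η ≤ y t₀) (h1 : Y t₀ ≤ m * y t₀) :
    η ≤ y t₁ := by
  have hcont : IsClosed {t | 0 ≤ y t - η ∧ 0 ≤ m * y t - Y t} :=
    (isClosed_le continuous_const (h.continuous_fst.sub continuous_const)).inter
      (isClosed_le continuous_const ((continuous_const.mul h.continuous_fst).sub h.continuous_snd))
  have hsub : Icc t₀ t₁ ⊆ {t | 0 ≤ y t - η ∧ 0 ≤ m * y t - Y t} := by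
    refine (hcont.inter isClosed_Icc).Icc_subset_of_forall_exists_gt
      ⟨sub_nonneg.2 h0, sub_nonneg.2 h1⟩ (fun t ht u hu => ?_)
    obtain ⟨⟨hy, hY⟩, htI⟩ := ht
    have e1 : ∀ᶠ x in 𝓝[>] t, 0 ≤ y x - η := by
      refine eventually_nonneg_nhdsGT_of_hasDerivAt ((h.hasDerivAt_fst t).sub_const η) hy
        (fun hy0 => ?_)
      have hyη : y t = η := by linarith
      rw [hyη] at hY ⊢
      have hΦ : |Y t| ^ s * Y t ≤ (m * η) ^ s * (m * η) := by
        rcases le_or_gt (Y t) 0 with hneg | hpos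
        · exact (mul_nonpos_of_nonneg_of_nonpos (by positivity) hneg).trans (by positivity)
        · rw [abs_of_pos hpos]
          have : Y t ≤ m * η := by linarith
          gcongr
      have := mul_lt_mul_of_pos_right hmη hη
      linarith
    have e2 : ∀ᶠ x in 𝓝[>] t, 0 ≤ m * y x - Y x := by
      refine eventually_nonneg_nhdsGT_of_hasDerivAt
        (((h.hasDerivAt_fst t).const_mul m).sub (h.hasDerivAt_snd t)) hY (fun hY0 => ?_)
      have hYm : Y t = m * y t := by linarith
      have hyη : η ≤ y t := by linarith
      have hypos : 0 < y t := hη.trans_le hyη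
      rw [hYm, abs_of_pos (by positivity)]
      have h2 : (m * η) ^ s ≤ (m * y t) ^ s := by gcongr
      have h3 := mul_le_mul_of_nonneg_left h2 (mul_nonneg (sub_nonneg.2 hm1) hm.le)
      have h4 := hbA t (ht₀.trans htI.1)
      have h5 : 0 < m * (δ - κ) + (1 - m) * m * (m * y t) ^ s - (α + b t) := by linarith
      have := mul_pos h5 hypos
      linarith
    have hIoc : Ioc t u ∈ 𝓝[>] t := Ioc_mem_nhdsGT hu
    obtain ⟨x, ⟨hx1, hx2⟩, hx3⟩ := ((e1.and e2).and hIoc).exists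
    exact ⟨x, ⟨hx1, hx2⟩, hx3⟩
  have := (hsub ⟨ht, le_rfl⟩).1
  linarith

theorem frequently_snd_eq_zero (h : IsPlaneSystem s δ κ α b y Y)
    (hz : ∃ᶠ t in atTop, y t = 0) : ∃ᶠ t in atTop, Y t = 0 := by
  rw [frequently_atTop] at hz ⊢
  intro T
  obtain ⟨t₁, ht₁, h1⟩ := hz T
  obtain ⟨t₂, ht₂, h2⟩ := hz (t₁ + 1)
  obtain ⟨c, hc, hc0⟩ := exists_hasDerivAt_eq_zero (f := fun t => Real.exp (-δ * t) * y t)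
    (f' := fun t => Real.exp (-δ * t) * (δ * y t - |Y t| ^ s * Y t - δ * y t))
    (by linarith : t₁ < t₂)
    (((Real.continuous_exp.comp (continuous_const.mul continuous_id)).mul
      h.continuous_fst).continuousOn) (by simp [h1, h2])
    (fun t _ => hasDerivAt_exp_neg_mul (h.hasDerivAt_fst t))
  refine ⟨c, ht₁.trans hc.1.le, ?_⟩
  by_contra hY
  have h3 : |Y c| ^ s * Y c ≠ 0 := mul_ne_zero (Real.rpow_pos_of_pos (abs_pos.2 hY) s).ne' hY
  have h4 := (Real.exp_pos (-δ * c)).ne'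
  rcases mul_eq_zero.1 hc0 with h5 | h5
  · exact h4 h5
  · exact h3 (by linarith)

theorem eventually_snd_le (h : IsPlaneSystem s δ κ α b y Y) (hs : 0 < s) (hα : 0 < α)
    {m A X₁ X₂ : ℝ} (hm : 0 < m) (hm1 : m ≤ 1) (hX₂ : 0 < X₂) (hX : X₂ ≤ X₁) (hκX : κ < X₁)
    (hmX : m * X₂ < δ) (hA : A < m * (δ - κ) + (1 - m) * m * X₂) (hA' : A ≤ m * (X₁ - κ))
    (hb : ∀ t, 0 ≤ b t) (hbA : ∀ᶠ t in atTop, α + b t ≤ A) (hz : ∃ᶠ t in atTop, y t = 0) :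
    ∀ᶠ t in atTop, Y t ≤ X₁ ^ (1 / s) := by
  obtain ⟨T, hT⟩ := eventually_atTop.1 hbA
  obtain ⟨t₀, ht₀, hY₀⟩ := frequently_atTop.1 (h.frequently_snd_eq_zero hz) T
  have hroot : ∀ X : ℝ, 0 < X → (X ^ (1 / s)) ^ s = X := fun X hX => by
    rw [← Real.rpow_mul hX.le, one_div_mul_cancel hs.ne', Real.rpow_one]
  have hX₁ : 0 < X₁ := hX₂.trans_le hX
  have hmη : m * (X₂ ^ (1 / s) / m) = X₂ ^ (1 / s) := by field_simp
  have hη : 0 < X₂ ^ (1 / s) / m := by positivity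
  refine eventually_atTop.2 ⟨t₀, fun t ht => ?_⟩
  refine le_of_hasDerivAt_neg_on_level ht (fun x _ => h.hasDerivAt_snd x)
    (by rw [hY₀]; positivity) (fun x hx hxY => ?_)
  by_contra! hcon
  have hY₁ : 0 < X₁ ^ (1 / s) := by positivity
  rw [hxY, abs_of_pos hY₁, hroot X₁ hX₁] at hcon
  have h1 : (X₁ - κ) * X₁ ^ (1 / s) ≤ (α + b x) * y x := by linarith
  have h2 : 0 < (X₁ - κ) * X₁ ^ (1 / s) := mul_pos (sub_pos.2 hκX) hY₁
  have h3 : 0 < α + b x := by linarith [hb x]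
  have h4 : 0 < y x := pos_of_mul_pos_right (h2.trans_le h1) h3.le
  have h5 := mul_le_mul_of_nonneg_right ((hT x (ht₀.trans hx.1)).trans hA') h4.le
  have h6 : X₁ ^ (1 / s) ≤ m * y x :=
    le_of_mul_le_mul_left (by linarith) (sub_pos.2 hκX)
  have h7 : X₂ ^ (1 / s) ≤ X₁ ^ (1 / s) := by gcongr
  have h8 : X₂ ^ (1 / s) / m ≤ y x := (div_le_iff₀ hm).2 (by linarith)
  obtain ⟨u, hu, hyu⟩ := frequently_atTop.1 hz x
  have h9 := h.sector_invariant hs hm hm1 hη (by rwa [hmη, hroot X₂ hX₂])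
    (by rwa [hmη, hroot X₂ hX₂]) hT (ht₀.trans hx.1) hu h8 (hxY ▸ h6)
  linarith

theorem eventually_fst_le (h : IsPlaneSystem s δ κ α b y Y) (hδ : 0 < δ) {M : ℝ} (hM : 0 ≤ M)
    (hΦ : ∀ᶠ t in atTop, |Y t| ^ s * Y t ≤ M) (hz : ∃ᶠ t in atTop, y t = 0) :
    ∀ᶠ t in atTop, y t ≤ M / δ := by
  obtain ⟨T, hT⟩ := eventually_atTop.1 hΦ
  refine eventually_atTop.2 ⟨T, fun t ht => ?_⟩
  by_contra! hcon
  obtain ⟨u, hu, hyu⟩ := frequently_atTop.1 hz t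
  have h1 : y t ≤ y u := ge_of_hasDerivAt_pos_on_level hu (fun x _ => h.hasDerivAt_fst x) le_rfl
    (fun x hx hxy => by
      have h2 := hT x (ht.trans hx.1)
      have h3 := (div_lt_iff₀ hδ).1 hcon
      rw [hxy]
      linarith)
  have : 0 ≤ M / δ := by positivity
  linarith

end IsPlaneSystem

theorem exists_sector_parameters {s δ κ α : ℝ} (hs : 0 < s) (hκ : 0 < κ) (hα : 0 < α)
    (hκα : δ - κ ≤ α) (hαδ : α < δ) (hstar : (s + 1) * (δ * κ) < (δ + κ) * (δ - α)) :
    ∃ X₁ m X₂ A : ℝ, 0 < m ∧ m ≤ 1 ∧ 0 < X₂ ∧ X₂ ≤ X₁ ∧ κ < X₁ ∧ m * X₂ < δ ∧ α < A ∧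
      A < m * (δ - κ) + (1 - m) * m * X₂ ∧ A ≤ m * (X₁ - κ) ∧ (s + 1) * X₁ < δ + κ ∧
      2 * ((δ - α) * X₁) < (s + 2) * (δ * κ) := by
  have hθ : 0 < δ - α := sub_pos.2 hαδ
  have hδ : 0 < δ := hα.trans hαδ
  have hδκ : 0 < δ * κ := mul_pos hδ hκ
  obtain ⟨X₁, hX₁, hX₁'⟩ : ∃ X₁, δ * κ / (δ - α) < X₁ ∧
      X₁ < min ((δ + κ) / (s + 1)) ((s + 2) * (δ * κ) / (2 * (δ - α))) := by
    refine exists_between (lt_min ?_ ?_)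
    · rw [div_lt_div_iff₀ hθ (by linarith)]; linarith
    · rw [div_lt_div_iff₀ hθ (by linarith)]
      have := mul_pos (mul_pos hs hδκ) hθ
      linarith
  obtain ⟨h1, h2⟩ := lt_min_iff.1 hX₁'
  rw [lt_div_iff₀ (by linarith)] at h1 h2
  rw [div_lt_iff₀ hθ] at hX₁
  have hX₁κ : κ < X₁ := lt_of_mul_lt_mul_right (by nlinarith) hθ.le
  have hX₁0 : 0 < X₁ := hκ.trans hX₁κ
  have hX₁κ' : 0 < X₁ - κ := sub_pos.2 hX₁κ
  obtain ⟨m, hm, hm'⟩ : ∃ m, max (δ / X₁) (α / (X₁ - κ)) < m ∧ m < (δ - α) / κ := by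
    refine exists_between (max_lt ?_ ?_)
    · rw [div_lt_div_iff₀ hX₁0 hκ]; linarith
    · rw [div_lt_div_iff₀ hX₁κ' hκ]; nlinarith
  obtain ⟨h3, h4⟩ := max_lt_iff.1 hm
  have hm0 : 0 < m := (by positivity : 0 < δ / X₁).trans h3
  rw [div_lt_iff₀ hX₁0] at h3
  rw [div_lt_iff₀ hX₁κ'] at h4
  rw [lt_div_iff₀ hκ] at hm'
  have hm1 : m < 1 := lt_of_mul_lt_mul_right (by linarith) hκ.le
  have hm1' : 0 < 1 - m := sub_pos.2 hm1
  have hmm : 0 < (1 - m) * m := mul_pos hm1' hm0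
  have hnum : 0 < α - m * (δ - κ) := by nlinarith
  obtain ⟨X₂, hX₂, hX₂'⟩ : ∃ X₂, (α - m * (δ - κ)) / ((1 - m) * m) < X₂ ∧ X₂ < δ / m := by
    refine exists_between ?_
    rw [div_lt_div_iff₀ hmm hm0]
    have : α - m * (δ - κ) < δ * (1 - m) := by linarith
    have := mul_lt_mul_of_pos_right this hm0
    linarith
  have hX₂0 : 0 < X₂ := (div_pos hnum hmm).trans hX₂
  rw [div_lt_iff₀ hmm] at hX₂
  rw [lt_div_iff₀ hm0] at hX₂'
  obtain ⟨A, hA, hA'⟩ : ∃ A, α < A ∧ A < min (m * (δ - κ) + (1 - m) * m * X₂) (m * (X₁ - κ)) :=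
    exists_between (lt_min (by linarith) h4)
  obtain ⟨h5, h6⟩ := lt_min_iff.1 hA'
  exact ⟨X₁, m, X₂, A, hm0, hm1.le, hX₂0, le_of_mul_le_mul_left (by linarith) hm0, hX₁κ,
    by linarith, hA, h5, h6.le, by linarith, by linarith⟩

theorem exists_perturbation_bound {s δ κ α X₁ : ℝ} (hs : 0 ≤ s) (hδ : 0 ≤ δ) (hκ : 0 ≤ κ)
    (hα : 0 < α) (hαδ : α ≤ δ) :
    ∃ C, 0 ≤ C ∧ ∀ X y Y : ℝ, 0 ≤ X → X ≤ X₁ →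
      |((κ - (s + 1) * X) * (κ * Y - X * Y + α * y) + (δ * κ * Y - (δ - α) * (X * Y))) * y| ≤
        C * ((κ * Y - X * Y + α * y) ^ 2 + Y ^ 2) := by
  set C₀ := κ + (s + 1) * |X₁| + (δ * κ + (δ - α) * |X₁|) + 1 with hC₀
  have hθ : 0 ≤ δ - α := sub_nonneg.2 hαδ
  have hδκ := mul_nonneg hδ hκ
  have hp1 : 0 ≤ (s + 1) * |X₁| := by positivity
  have hp2 : 0 ≤ (δ - α) * |X₁| := by positivity
  have hC0 : 0 ≤ C₀ := by positivity
  refine ⟨2 * C₀ ^ 2 / α, by positivity, fun X y Y hX0 hX => ?_⟩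
  obtain ⟨U, hU⟩ : ∃ U, U = κ * Y - X * Y + α * y := ⟨_, rfl⟩
  rw [← hU]
  have hX' : X ≤ |X₁| := hX.trans (le_abs_self _)
  have hq1 := mul_le_mul_of_nonneg_left hX' (by linarith : 0 ≤ s + 1)
  have hq2 := mul_le_mul_of_nonneg_left hX' hθ
  have hq3 := mul_nonneg (by linarith : 0 ≤ s + 1) hX0
  have hq4 := mul_nonneg hθ hX0
  have hq5 := mul_nonneg hs hX0
  have h1 : |κ - (s + 1) * X| ≤ C₀ := abs_le.2 ⟨by linarith, by linarith⟩
  have h2 : |δ * κ - (δ - α) * X| ≤ C₀ := abs_le.2 ⟨by linarith, by linarith⟩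
  have h3 : |κ - X| ≤ C₀ := abs_le.2 ⟨by linarith, by linarith⟩
  have h4 : |α * y| ≤ C₀ * (|U| + |Y|) := by
    calc |α * y| = |U - (κ - X) * Y| := by rw [hU]; ring_nf
      _ ≤ |U| + |κ - X| * |Y| := by rw [← abs_mul]; exact abs_sub _ _
      _ ≤ C₀ * |U| + C₀ * |Y| := add_le_add
          (le_mul_of_one_le_left (abs_nonneg _) (by linarith))
          (mul_le_mul_of_nonneg_right h3 (abs_nonneg _))
      _ = _ := by ring
  have h5 : |(κ - (s + 1) * X) * U + (δ * κ * Y - (δ - α) * (X * Y))| ≤ C₀ * (|U| + |Y|) := by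
    calc _ = |(κ - (s + 1) * X) * U + (δ * κ - (δ - α) * X) * Y| := by ring_nf
      _ ≤ |κ - (s + 1) * X| * |U| + |δ * κ - (δ - α) * X| * |Y| := by
          rw [← abs_mul, ← abs_mul]; exact abs_add_le _ _
      _ ≤ C₀ * |U| + C₀ * |Y| := by gcongr
      _ = _ := by ring
  rw [div_mul_eq_mul_div, le_div_iff₀ hα]
  calc _ = |(κ - (s + 1) * X) * U + (δ * κ * Y - (δ - α) * (X * Y))| * |α * y| := by
        rw [abs_mul, abs_mul, abs_of_pos hα]; ring
    _ ≤ (C₀ * (|U| + |Y|)) * (C₀ * (|U| + |Y|)) := by gcongr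
    _ = C₀ ^ 2 * (|U| + |Y|) ^ 2 := by ring
    _ ≤ C₀ ^ 2 * (2 * (U ^ 2 + Y ^ 2)) := by
        gcongr
        nlinarith [sq_nonneg (|U| - |Y|), sq_abs U, sq_abs Y]
    _ = _ := by ring

namespace IsPlaneSystem

variable {s δ κ α : ℝ} {b y Y : ℝ → ℝ}

/-- The energy of the limiting autonomous system. -/
noncomputable def planeEnergy (s δ κ α : ℝ) (y Y : ℝ → ℝ) (t : ℝ) : ℝ :=
  (κ * Y t - |Y t| ^ s * Y t + α * y t) ^ 2 / 2 + δ * κ * (Y t ^ 2 / 2)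
    - (δ - α) * (|Y t| ^ (s + 2) / (s + 2))

theorem hasDerivAt_velocity (h : IsPlaneSystem s δ κ α b y Y) (hs : 0 < s) (t : ℝ) :
    HasDerivAt (fun t => κ * Y t - |Y t| ^ s * Y t + α * y t)
      ((κ - (s + 1) * |Y t| ^ s) * (κ * Y t - |Y t| ^ s * Y t + (α + b t) * y t)
        + α * (δ * y t - |Y t| ^ s * Y t)) t := by
  have hY := h.hasDerivAt_snd t
  refine (((hY.const_mul κ).sub ((hasDerivAt_abs_rpow_mul_self hs (Y t)).comp t hY)).add
    ((h.hasDerivAt_fst t).const_mul α)).congr_deriv ?_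
  ring

theorem hasDerivAt_planeEnergy (h : IsPlaneSystem s δ κ α b y Y) (hs : 0 < s) (t : ℝ) :
    HasDerivAt (planeEnergy s δ κ α y Y)
      ((δ + κ - (s + 1) * |Y t| ^ s) * (κ * Y t - |Y t| ^ s * Y t + α * y t) ^ 2
        + b t * (((κ - (s + 1) * |Y t| ^ s) * (κ * Y t - |Y t| ^ s * Y t + α * y t)
          + (δ * κ * Y t - (δ - α) * (|Y t| ^ s * Y t))) * y t)) t := by
  have hY := h.hasDerivAt_snd t
  refine (((((h.hasDerivAt_velocity hs t).pow 2).div_const 2).add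
    (((hY.pow 2).div_const 2).const_mul (δ * κ))).sub
    (((hasDerivAt_abs_rpow_add_two hs.le (Y t)).comp t hY).const_mul (δ - α))).congr_deriv ?_
  push_cast
  ring

theorem exists_le_planeEnergy (hs : 0 < s) {X₁ : ℝ} (hαδ : α ≤ δ)
    (hX₁ : 2 * ((δ - α) * X₁) < (s + 2) * (δ * κ)) :
    ∃ c, 0 < c ∧ ∀ (y Y : ℝ → ℝ) t, |Y t| ^ s ≤ X₁ →
      c * ((κ * Y t - |Y t| ^ s * Y t + α * y t) ^ 2 + Y t ^ 2) ≤ planeEnergy s δ κ α y Y t := by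
  have hpos : 0 < δ * κ / 2 - (δ - α) * X₁ / (s + 2) := by
    rw [sub_pos, div_lt_div_iff₀ (by linarith) two_pos]; linarith
  refine ⟨min (1 / 2) (δ * κ / 2 - (δ - α) * X₁ / (s + 2)), lt_min (by norm_num) hpos,
    fun y Y t hX => ?_⟩
  rw [planeEnergy, ← abs_rpow_mul_sq hs.le]
  have h1 := mul_le_mul_of_nonneg_right (min_le_left (1 / 2 : ℝ)
    (δ * κ / 2 - (δ - α) * X₁ / (s + 2))) (sq_nonneg (κ * Y t - |Y t| ^ s * Y t + α * y t))
  have h2 := mul_le_mul_of_nonneg_right (min_le_right (1 / 2 : ℝ)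
    (δ * κ / 2 - (δ - α) * X₁ / (s + 2))) (sq_nonneg (Y t))
  have h3 : (δ - α) * (|Y t| ^ s * Y t ^ 2 / (s + 2)) ≤ (δ - α) * X₁ / (s + 2) * Y t ^ 2 := by
    rw [mul_div_assoc', div_mul_eq_mul_div]
    refine div_le_div_of_nonneg_right ?_ (by linarith)
    have := mul_le_mul_of_nonneg_right
      (mul_le_mul_of_nonneg_left hX (sub_nonneg.2 hαδ)) (sq_nonneg (Y t))
    linarith
  linarith

theorem not_frequently_snd_eq_zero_of_bounded (h : IsPlaneSystem s δ κ α b y Y) (hs : 0 < s)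
    (hδ : 0 < δ) (hκ : 0 < κ) (hα : 0 < α) (hαδ : α ≤ δ) {X₁ M B c T : ℝ}
    (hD : (s + 1) * X₁ < δ + κ) (hX₁ : 2 * ((δ - α) * X₁) < (s + 2) * (δ * κ)) (hB : 0 ≤ B)
    (hc : 0 < c) (hX : ∀ t, T ≤ t → |Y t| ^ s ≤ X₁) (hy : ∀ t, T ≤ t → |y t| ≤ M)
    (hY : ∀ t, T ≤ t → |Y t| ≤ M) (hb : ∀ t, T ≤ t → 0 ≤ b t ∧ b t ≤ B * Real.exp (-c * t))
    (hne : y T ≠ 0 ∨ Y T ≠ 0) : ¬ ∃ᶠ t in atTop, Y t = 0 := by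
  intro hz
  obtain ⟨c₁, hc₁, hlow⟩ := exists_le_planeEnergy (α := α) hs hαδ hX₁
  obtain ⟨C, hC, hpert⟩ := exists_perturbation_bound (X₁ := X₁) hs.le hδ.le hκ.le hα hαδ
  obtain ⟨G, hG⟩ : ∃ G, G = C * B / c₁ := ⟨_, rfl⟩
  have hG0 : 0 ≤ G := by rw [hG]; positivity
  obtain ⟨E, hE⟩ : ∃ E : ℝ → ℝ, E = fun t => Real.exp (-(G / c) * Real.exp (-c * t)) := ⟨_, rfl⟩
  have hE0 : ∀ t, 0 < E t := fun t => by rw [hE]; exact Real.exp_pos _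
  have hE1 : ∀ t, E t ≤ 1 := fun t => by
    rw [hE, Real.exp_le_one_iff]
    have := mul_nonneg (div_nonneg hG0 hc.le) (Real.exp_pos (-c * t)).le
    linarith
  have hEd : ∀ t, HasDerivAt E (E t * (G * Real.exp (-c * t))) t := fun t => by
    rw [hE]
    refine ((((hasDerivAt_id' t).const_mul (-c)).exp).const_mul (-(G / c))).exp.congr_deriv ?_
    field_simp
  have hEm : MonotoneOn E univ := monotoneOn_of_hasDerivAt_nonneg convex_univ (fun t _ => hEd t)
    (fun t _ => mul_nonneg (hE0 t).le (mul_nonneg hG0 (Real.exp_pos _).le))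
  have hM0 : 0 ≤ M := (abs_nonneg _).trans (hy T le_rfl)
  have hX₁0 : 0 ≤ X₁ := le_trans (by positivity) (hX T le_rfl)
  obtain ⟨U, hU⟩ : ∃ U : ℝ → ℝ, U = fun t => κ * Y t - |Y t| ^ s * Y t + α * y t := ⟨_, rfl⟩
  have hUt : ∀ t, κ * Y t - |Y t| ^ s * Y t + α * y t = U t := fun t => by rw [hU]
  have hUd := h.hasDerivAt_velocity hs
  have hHd := h.hasDerivAt_planeEnergy hs
  simp only [hUt] at hUd hHd hpert
  have hlow' : ∀ t, T ≤ t → c₁ * (U t ^ 2 + Y t ^ 2) ≤ planeEnergy s δ κ α y Y t :=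
    fun t ht => by have := hlow y Y t (hX t ht); rwa [hUt] at this
  have hE' : ∀ t, T ≤ t → 0 ≤ planeEnergy s δ κ α y Y t :=
    fun t ht => le_trans (by positivity) (hlow' t ht)
  have hdiss : ∀ t, T ≤ t → (δ + κ - (s + 1) * X₁) * U t ^ 2 -
      G * Real.exp (-c * t) * planeEnergy s δ κ α y Y t ≤
      (δ + κ - (s + 1) * |Y t| ^ s) * U t ^ 2
        + b t * (((κ - (s + 1) * |Y t| ^ s) * U t
          + (δ * κ * Y t - (δ - α) * (|Y t| ^ s * Y t))) * y t) := by
    intro t ht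
    have h1 := (abs_le.1 (hpert (|Y t| ^ s) (y t) (Y t) (by positivity) (hX t ht))).1
    rw [hUt] at h1
    have h2 := mul_le_mul_of_nonneg_left h1 (hb t ht).1
    have h3 : b t * (C * (U t ^ 2 + Y t ^ 2)) ≤
        G * Real.exp (-c * t) * planeEnergy s δ κ α y Y t := by
      calc b t * (C * (U t ^ 2 + Y t ^ 2))
          ≤ B * Real.exp (-c * t) * (C * (U t ^ 2 + Y t ^ 2)) := by
            have := (hb t ht).2
            gcongr
        _ = G * Real.exp (-c * t) * (c₁ * (U t ^ 2 + Y t ^ 2)) := by rw [hG]; field_simp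
        _ ≤ _ := by
            have := hlow' t ht
            gcongr
    have h4 := mul_le_mul_of_nonneg_right
      (mul_le_mul_of_nonneg_left (hX t ht) (by linarith : 0 ≤ s + 1)) (sq_nonneg (U t))
    linarith
  have hUM : ∀ t, T ≤ t → |U t| ≤ (κ + X₁ + α) * M := by
    intro t ht
    rw [← hUt]
    have h1 : |(κ - |Y t| ^ s)| ≤ κ + X₁ := by
      have h0 : 0 ≤ |Y t| ^ s := by positivity
      exact abs_le.2 ⟨by linarith [hX t ht], by linarith⟩
    calc |κ * Y t - |Y t| ^ s * Y t + α * y t| = |(κ - |Y t| ^ s) * Y t + α * y t| := by ring_nf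
      _ ≤ |(κ - |Y t| ^ s)| * |Y t| + α * |y t| := by
          rw [← abs_mul, ← abs_of_pos hα, ← abs_mul, abs_of_pos hα]; exact abs_add_le _ _
      _ ≤ (κ + X₁) * M + α * M := by gcongr <;> [exact hY t ht; exact hy t ht]
      _ = _ := by ring
  have hU'M : ∃ L, ∀ t, T ≤ t →
      |(κ - (s + 1) * |Y t| ^ s) * (κ * Y t - |Y t| ^ s * Y t + (α + b t) * y t)
        + α * (δ * y t - |Y t| ^ s * Y t)| ≤ L := by
    refine ⟨(κ + (s + 1) * X₁) * ((κ + X₁ + α) * M + B * Real.exp (-c * T) * M)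
      + α * (δ * M + X₁ * M), fun t ht => ?_⟩
    have h0 : 0 ≤ |Y t| ^ s := by positivity
    have h1 := mul_le_mul_of_nonneg_left (hX t ht) (by linarith : 0 ≤ s + 1)
    have h1' := mul_nonneg (by linarith : 0 ≤ s + 1) h0
    have h2 : |κ - (s + 1) * |Y t| ^ s| ≤ κ + (s + 1) * X₁ :=
      abs_le.2 ⟨by linarith, by linarith⟩
    have h3 : |b t * y t| ≤ B * Real.exp (-c * T) * M := by
      rw [abs_mul, abs_of_nonneg (hb t ht).1]
      refine mul_le_mul ((hb t ht).2.trans ?_) (hy t ht) (abs_nonneg _) (by positivity)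
      refine mul_le_mul_of_nonneg_left (Real.exp_le_exp.2 ?_) hB
      nlinarith
    have h4 : |δ * y t - |Y t| ^ s * Y t| ≤ δ * M + X₁ * M := by
      refine (abs_sub _ _).trans ?_
      rw [abs_mul, abs_mul, abs_of_pos hδ, abs_of_nonneg h0]
      exact add_le_add (mul_le_mul_of_nonneg_left (hy t ht) hδ.le)
        (mul_le_mul (hX t ht) (hY t ht) (abs_nonneg _) hX₁0)
    have h5 : |κ * Y t - |Y t| ^ s * Y t + (α + b t) * y t| ≤
        (κ + X₁ + α) * M + B * Real.exp (-c * T) * M := by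
      calc _ = |U t + b t * y t| := by rw [← hUt]; ring_nf
        _ ≤ _ := (abs_add_le _ _).trans (add_le_add (hUM t ht) h3)
    refine (abs_add_le _ _).trans ?_
    rw [abs_mul, abs_mul, abs_of_pos hα]
    gcongr
  obtain ⟨L, hL⟩ := hU'M
  have hL0 : 0 ≤ L := (abs_nonneg _).trans (hL T le_rfl)
  have hHT : 0 < planeEnergy s δ κ α y Y T := by
    refine lt_of_lt_of_le (mul_pos hc₁ ?_) (hlow' T le_rfl)
    rcases eq_or_ne (Y T) 0 with h0 | h0
    · have hyT : y T ≠ 0 := hne.resolve_right (fun h1 => h1 h0)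
      have : U T = α * y T := by rw [← hUt, h0]; ring
      rw [this]
      positivity
    · positivity
  have hKd : ∀ t, HasDerivAt (fun t => planeEnergy s δ κ α y Y t * E t) _ t :=
    fun t => (hHd t).mul (hEd t)
  have hKineq : ∀ t, T ≤ t → (δ + κ - (s + 1) * X₁) * E T * U t ^ 2 ≤
      ((δ + κ - (s + 1) * |Y t| ^ s) * U t ^ 2
        + b t * (((κ - (s + 1) * |Y t| ^ s) * U t
          + (δ * κ * Y t - (δ - α) * (|Y t| ^ s * Y t))) * y t)) * E t +
      planeEnergy s δ κ α y Y t * (E t * (G * Real.exp (-c * t))) := by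
    intro t ht
    have h1 := mul_le_mul_of_nonneg_right (hdiss t ht) (hE0 t).le
    have h2 := mul_le_mul_of_nonneg_left (hEm (mem_univ T) (mem_univ t) ht)
      (mul_nonneg (sub_pos.2 hD).le (sq_nonneg (U t)))
    linarith
  refine not_frequently_le_of_dissipation (V := fun t => U t ^ 2)
    (v := 2 * (planeEnergy s δ κ α y Y T * E T)) (L := 2 * ((κ + X₁ + α) * M * L) + 1)
    (M := ((κ + X₁ + α) * M) ^ 2 / 2 + δ * κ * (M ^ 2 / 2))
    (mul_pos (sub_pos.2 hD) (hE0 T)) (by positivity) (mul_pos two_pos (mul_pos hHT (hE0 T)))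
    (fun t _ => hKd t) (fun t _ => (hUd t).pow 2) (fun t => sq_nonneg _)
    hKineq (fun t ht => ?_) (fun t ht => ?_) ?_
  · have h1 := mul_le_mul (hUM t ht) (hL t ht) (abs_nonneg _) (by positivity)
    rw [← abs_mul] at h1
    have h2 := (abs_le.1 h1).1
    push_cast
    simp only [pow_one]
    linarith
  · have h1 : planeEnergy s δ κ α y Y t ≤
        ((κ + X₁ + α) * M) ^ 2 / 2 + δ * κ * (M ^ 2 / 2) := by
      rw [planeEnergy, hUt]
      have h2 : U t ^ 2 ≤ ((κ + X₁ + α) * M) ^ 2 := sq_le_sq' (abs_le.1 (hUM t ht)).1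
        (abs_le.1 (hUM t ht)).2
      have h3 : Y t ^ 2 ≤ M ^ 2 := sq_le_sq' (abs_le.1 (hY t ht)).1 (abs_le.1 (hY t ht)).2
      have h4 : δ * κ * (Y t ^ 2 / 2) ≤ δ * κ * (M ^ 2 / 2) := by gcongr
      have h5 : 0 ≤ (δ - α) * (|Y t| ^ (s + 2) / (s + 2)) :=
        mul_nonneg (sub_nonneg.2 hαδ) (by positivity)
      linarith
    exact (mul_le_of_le_one_right (hE' t ht) (hE1 t)).trans h1
  · refine (hz.and_eventually (eventually_ge_atTop T)).mono fun t ⟨hYt, ht⟩ => ?_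
    have hmono : MonotoneOn (fun t => planeEnergy s δ κ α y Y t * E t) (Ici T) :=
      monotoneOn_of_hasDerivAt_nonneg (convex_Ici _) (fun t _ => hKd t) (fun t ht =>
        (mul_nonneg (mul_nonneg (sub_pos.2 hD).le (hE0 T).le) (sq_nonneg _)).trans (hKineq t ht))
    have h1 := hmono (mem_Ici.2 le_rfl) ht ht
    have h2 := h1.trans (mul_le_of_le_one_right (hE' t ht) (hE1 t))
    have h3 : planeEnergy s δ κ α y Y t = U t ^ 2 / 2 := by
      rw [planeEnergy, hUt, hYt, abs_zero, Real.zero_rpow (by linarith)]; ring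
    linarith

theorem not_frequently_fst_eq_zero (h : IsPlaneSystem s δ κ α b y Y) (hs : 0 < s) (hκ : 0 < κ)
    (hα : 0 < α) (hκα : δ - κ ≤ α) (hαδ : α < δ)
    (hstar : (s + 1) * (δ * κ) < (δ + κ) * (δ - α)) {B c : ℝ} (hB : 0 ≤ B) (hc : 0 < c)
    (hb : ∀ t, 0 ≤ b t) (hbB : ∀ t, 0 ≤ t → b t ≤ B * Real.exp (-c * t))
    (hne : ∀ t, y t ≠ 0 ∨ Y t ≠ 0) : ¬ ∃ᶠ t in atTop, y t = 0 := by
  intro hz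
  have hδ : 0 < δ := hα.trans hαδ
  obtain ⟨X₁, m, X₂, A, hm, hm1, hX₂, hX, hκX, hmX, hαA, hA, hA', hD, hX₁⟩ :=
    exists_sector_parameters hs hκ hα hκα hαδ hstar
  have hX₁0 : 0 < X₁ := hX₂.trans_le hX
  have hbA : ∀ᶠ t in atTop, α + b t ≤ A := by
    have h1 : Tendsto (fun t => B * Real.exp (-c * t)) atTop (𝓝 (B * 0)) := by
      refine (Real.tendsto_exp_atBot.comp ?_).const_mul B
      exact tendsto_id.const_mul_atTop_of_neg (neg_lt_zero.2 hc)
    rw [mul_zero] at h1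
    filter_upwards [h1.eventually (gt_mem_nhds (sub_pos.2 hαA)), eventually_ge_atTop 0]
      with t ht ht0
    have := hbB t ht0
    linarith
  have hz' : ∃ᶠ t in atTop, -y t = 0 := hz.mono fun t ht => by rw [ht, neg_zero]
  have hY : ∀ᶠ t in atTop, |Y t| ≤ X₁ ^ (1 / s) := by
    filter_upwards [h.eventually_snd_le hs hα hm hm1 hX₂ hX hκX hmX hA hA' hb hbA hz,
      h.neg.eventually_snd_le hs hα hm hm1 hX₂ hX hκX hmX hA hA' hb hbA hz'] with t h1 h2
    exact abs_le.2 ⟨by linarith, h1⟩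
  have hYX : ∀ t, |Y t| ≤ X₁ ^ (1 / s) → |Y t| ^ s ≤ X₁ := fun t ht => by
    have := Real.rpow_le_rpow (abs_nonneg _) ht hs.le
    rwa [← Real.rpow_mul hX₁0.le, one_div_mul_cancel hs.ne', Real.rpow_one] at this
  obtain ⟨M, hM⟩ : ∃ M, M = X₁ * X₁ ^ (1 / s) := ⟨_, rfl⟩
  have hM0 : 0 ≤ M := by rw [hM]; positivity
  have hΦ : ∀ᶠ t in atTop, |(|Y t| ^ s * Y t)| ≤ M := hY.mono fun t ht => by
    rw [abs_mul, abs_of_nonneg (by positivity : 0 ≤ |Y t| ^ s), hM]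
    exact mul_le_mul (hYX t ht) ht (abs_nonneg _) hX₁0.le
  have hy : ∀ᶠ t in atTop, |y t| ≤ M / δ := by
    filter_upwards [h.eventually_fst_le hδ hM0 (hΦ.mono fun t ht => (abs_le.1 ht).2) hz,
      h.neg.eventually_fst_le hδ hM0 (hΦ.mono fun t ht => by
        rw [abs_neg]; linarith [(abs_le.1 ht).1]) hz'] with t h1 h2
    exact abs_le.2 ⟨by linarith, h1⟩
  obtain ⟨T, hT⟩ := eventually_atTop.1 ((hY.and hy).and (eventually_ge_atTop 0))
  exact h.not_frequently_snd_eq_zero_of_bounded hs hδ hκ hα hαδ.le (M := max (X₁ ^ (1 / s)) (M / δ))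
    hD hX₁ hB hc (fun t ht => hYX t (hT t ht).1.1) (fun t ht => (hT t ht).1.2.trans
    (le_max_right _ _)) (fun t ht => (hT t ht).1.1.trans (le_max_left _ _))
    (fun t ht => ⟨hb t, hbB t (hT t ht).2⟩) (hne T) (h.frequently_snd_eq_zero hz)

end IsPlaneSystem

namespace IsRadialSystem

variable {n s k α δ : ℝ} {w P : ℝ → ℝ}

theorem continuous_comp_exp (h : IsRadialSystem n s k α w P) :
    Continuous fun t => w (Real.exp t) :=
  continuous_iff_continuousAt.2 fun t =>
    (h.hasDerivAt_fst _ (Real.exp_pos t)).continuousAt.comp Real.continuous_exp.continuousAt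

theorem fst_ne_zero_or_snd_ne_zero (h : IsRadialSystem n s k α w P) (hs : 0 < s) (hk : 0 < k)
    (hδ : s * (δ - 1) = 2) (hn : 0 ≤ n) (hnα : n ≤ α) (hαδ : α ≤ δ)
    (hw : ContinuousWithinAt w (Ici 0) 0) (hw0 : w 0 ≠ 0) {r : ℝ} (hr : 0 < r) :
    w r ≠ 0 ∨ P r ≠ 0 := by
  by_contra! hcon
  obtain ⟨hwr, hPr⟩ := hcon
  have hzero : ∀ x ∈ Ioc 0 r, w x = 0 := by
    intro x hx
    have h1 := (h.isPlaneSystem hδ).fst_eq_zero_of_le hs.le (by linarith) (by linarith)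
      (by linarith) (fun t => by positivity)
      ((continuous_abs_rpow hk.le).comp h.continuous_comp_exp) (t₀ := Real.log r)
      (t₁ := Real.log x) (by rw [Real.exp_log hr, hwr, mul_zero])
      (by rw [Real.exp_log hr, hPr, mul_zero, neg_zero]) (Real.log_le_log hx.1 hx.2)
    rw [Real.exp_log hx.1] at h1
    exact (mul_eq_zero.1 h1).resolve_left (Real.exp_pos _).ne'
  have h2 : Tendsto w (𝓝[>] 0) (𝓝 (w 0)) :=
    hw.tendsto.mono_left (nhdsWithin_mono _ Ioi_subset_Ici_self)
  have h3 : Tendsto w (𝓝[>] 0) (𝓝 0) :=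
    tendsto_const_nhds.congr' (by
      filter_upwards [Ioc_mem_nhdsGT hr] with x hx using (hzero x hx).symm)
  exact hw0 (tendsto_nhds_unique h2 h3)

theorem finite_zeros (h : IsRadialSystem n s k α w P) (hs : 0 < s) (hk : 0 < k)
    (hδ : s * (δ - 1) = 2) (hn : 1 ≤ n) (hnα : n ≤ α) (hαδ : α < δ)
    (hstar : (s + 1) * (δ * (δ - n)) < (δ + (δ - n)) * (δ - α))
    (hw : ContinuousWithinAt w (Ici 0) 0) (hw0 : w 0 ≠ 0) :
    {r : ℝ | r ∈ Ici (0 : ℝ) ∧ w r = 0}.Finite := by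
  have hne := fun r hr => h.fst_ne_zero_or_snd_ne_zero hs hk hδ (by linarith) hnα hαδ.le hw hw0
    (r := r) hr
  obtain ⟨C, hC, hdecay⟩ := h.exists_abs_le_rpow_neg_half hn hs.le hk.le (hn.trans hnα)
  have hlarge := (h.isPlaneSystem hδ).not_frequently_fst_eq_zero hs (by linarith) (by linarith)
    (by linarith) hαδ hstar (B := C ^ k) (c := k / 2) (by positivity) (by positivity)
    (fun t => by positivity) (fun t ht => ?_) (fun t => ?_)
  · obtain ⟨T, hT⟩ := eventually_atTop.1 (not_frequently.1 hlarge)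
    by_contra hinf
    have hsub : {r : ℝ | r ∈ Ici (0 : ℝ) ∧ w r = 0} ⊆ Icc 0 (Real.exp T) := by
      rintro r ⟨hr, hwr⟩
      refine ⟨hr, le_of_not_gt fun hlt => hT (Real.log r) ?_ ?_⟩
      · exact ((Real.lt_log_iff_exp_lt ((Real.exp_pos T).trans hlt)).2 hlt).le
      · rw [Real.exp_log ((Real.exp_pos T).trans hlt), hwr, mul_zero]
    obtain ⟨x, hx, hacc⟩ := Set.Infinite.exists_accPt_of_subset_isCompact hinf isCompact_Icc hsub
    have hfreq := accPt_iff_frequently_nhdsNE.1 hacc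
    rcases hx.1.eq_or_lt with rfl | hx0
    · have h1 := eventually_nhdsWithin_iff.1 (hw.eventually_ne hw0)
      obtain ⟨z, ⟨hz1, hz2⟩, hz3⟩ :=
        (hfreq.and_eventually (nhdsWithin_le_nhds h1)).exists
      exact hz3 hz1 hz2
    · have hd := h.hasDerivAt_fst x hx0
      have hwx : w x = 0 := by
        by_contra hwx
        obtain ⟨z, hz1, hz2⟩ :=
          (hfreq.and_eventually (nhdsWithin_le_nhds (hd.continuousAt.eventually_ne hwx))).exists
        exact hz2 hz1.2
      have hPx := (hne x hx0).resolve_left (fun h1 => h1 hwx)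
      have hd0 : |P x| ^ s * P x ≠ 0 :=
        mul_ne_zero (Real.rpow_pos_of_pos (abs_pos.2 hPx) s).ne' hPx
      obtain ⟨z, hz1, hz2⟩ := (hfreq.and_eventually (hd.eventually_ne (c := 0) hd0)).exists
      exact hz2 hz1.2
  · have h1 := hdecay _ (Real.one_le_exp ht)
    calc |w (Real.exp t)| ^ k ≤ (C * Real.exp t ^ (-(1 / 2) : ℝ)) ^ k := by gcongr
      _ = C ^ k * Real.exp (-(k / 2) * t) := by
        rw [Real.mul_rpow hC.le (by positivity), ← Real.exp_mul, ← Real.exp_mul]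
        ring_nf
  · refine (hne _ (Real.exp_pos t)).imp (fun h1 => mul_ne_zero (Real.exp_pos _).ne' h1)
      (fun h1 => neg_ne_zero.2 (mul_ne_zero (Real.exp_pos _).ne' h1))

end IsRadialSystem

theorem exists_infinite_zeros_of_isRadialSystem {n s k δ : ℝ} (hn : 1 ≤ n) (hs : 0 < s)
    (hk : 0 < k) (hδ : s * (δ - 1) = 2) (hnδ : n < δ) :
    ∃ ε, 0 < ε ∧ ∀ α w P, n ≤ α → α < δ → δ - α < ε → IsRadialSystem n s k α w P →
      {r : ℝ | r ∈ Ici (0 : ℝ) ∧ w r = 0}.Infinite := by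
  have hκ : 0 < δ - n := sub_pos.2 hnδ
  obtain ⟨K, hK⟩ := exists_radialEnergy_one_le (A₀ := δ) hn hs hk
  obtain ⟨R, hR⟩ : ∃ R, R = 1 + (s + 2) * |K| := ⟨_, rfl⟩
  have hR0 : 0 ≤ R := by rw [hR]; positivity
  obtain ⟨θ₀, Z, hθ₀, hZ⟩ := exists_uniform_bound_isPlaneSystem (B := R ^ k) hs
    (by linarith : 0 < δ) hκ (by positivity) hR0
  refine ⟨min θ₀ ((δ - n) * (δ - n) ^ (1 / s) / 2 / (2 * (|Z| + 1))), lt_min hθ₀ (by positivity),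
    fun α w P hnα hαδ hε h hfin => ?_⟩
  obtain ⟨hε₁, hε₂⟩ := lt_min_iff.1 hε
  have hnot_pos : ∀ w P, IsRadialSystem n s k α w P → ¬ ∃ r₀, ∀ r, r₀ ≤ r → 0 < w r := by
    rintro w P h ⟨r₀, hpos⟩
    have hE := hK α w P (by linarith) hαδ.le h
    have hbound : ∀ r, 1 ≤ r → |w r| ≤ R ∧ |P r| ≤ R := by
      intro r hr
      obtain ⟨h1, h2⟩ := h.abs_le_of_one_le hn hs.le hk.le (hn.trans hnα) hr
      have h3 := hE.trans (le_abs_self K)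
      have h4 := mul_le_mul_of_nonneg_left h3 (by linarith : 0 ≤ s + 2)
      have h5 := mul_nonneg hs.le (abs_nonneg K)
      rw [hR]
      exact ⟨by linarith, by linarith⟩
    have hsys := h.isPlaneSystem hδ
    have hZ' := hZ α _ _ _ (hn.trans hnα) hαδ.le hε₁ hsys
      (fun t ht => ⟨by positivity, by have := (hbound _ (Real.one_le_exp ht)).1; gcongr⟩)
      (by simpa using (hbound 1 le_rfl).1) (by simpa using (hbound 1 le_rfl).2)
    refine hsys.not_eventually_pos_of_bounded hs (by linarith) hκ (by linarith) (by linarith)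
      hαδ.le (fun t => by positivity) hZ' ?_ (T := |r₀|) (fun t ht => ?_)
    · refine le_trans ?_ ((lt_div_iff₀ (by positivity)).1 hε₂).le
      have := le_abs_self Z
      have := sub_pos.2 hαδ
      gcongr
      linarith
    · refine mul_pos (Real.exp_pos _) (hpos _ ?_)
      have := Real.add_one_le_exp t
      linarith [le_abs_self r₀]
  obtain ⟨M, hM⟩ := hfin.bddAbove
  obtain ⟨R₁, hR₁⟩ : ∃ R₁, R₁ = |M| + 1 := ⟨_, rfl⟩
  have hR₁0 : 0 < R₁ := by rw [hR₁]; positivity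
  have hne : ∀ r, R₁ ≤ r → w r ≠ 0 := fun r hr hwr => by
    have := hM (⟨mem_Ici.2 (by linarith), hwr⟩ : r ∈ {r : ℝ | r ∈ Ici (0 : ℝ) ∧ w r = 0})
    linarith [le_abs_self M]
  have hcont : ∀ r, ContinuousOn w (Icc R₁ r) := fun r x hx =>
    (h.hasDerivAt_fst x (hR₁0.trans_le hx.1)).continuousAt.continuousWithinAt
  rcases lt_or_gt_of_ne (hne R₁ le_rfl) with hneg | hpos
  · refine hnot_pos _ _ h.neg ⟨R₁, fun r hr => neg_pos.2 (lt_of_not_ge fun hge => ?_)⟩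
    obtain ⟨c, hc, hc0⟩ := intermediate_value_Icc hr (hcont r) ⟨hneg.le, hge⟩
    exact hne c hc.1 hc0
  · refine hnot_pos _ _ h ⟨R₁, fun r hr => lt_of_not_ge fun hge => ?_⟩
    obtain ⟨c, hc, hc0⟩ := intermediate_value_Icc' hr (hcont r) ⟨hge, hpos.le⟩
    exact hne c hc.1 hc0

/-! ### Solutions of the equation as radial systems -/

theorem abs_phiP_rpow_mul_phiP {p : ℝ} (hp : 1 < p) (x : ℝ) :
    |phiP p x| ^ ((2 - p) / (p - 1)) * phiP p x = x := by
  rcases eq_or_ne x 0 with rfl | hx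
  · simp [phiP]
  have hx' : 0 < |x| := abs_pos.2 hx
  have hp1 : p - 1 ≠ 0 := by linarith
  have h1 : |phiP p x| = |x| ^ (p - 1) := by
    rw [phiP, abs_mul, abs_of_nonneg (by positivity), ← Real.rpow_add_one hx'.ne']
    ring_nf
  rw [h1, ← Real.rpow_mul hx'.le, mul_div_cancel₀ _ hp1, phiP, ← mul_assoc,
    ← Real.rpow_add hx']
  simp

theorem IsGlobalSolution.isRadialSystem {N : ℕ} {p q α a : ℝ} {w : ℝ → ℝ} (hp : 1 < p)
    (h : IsGlobalSolution N p q α a w) :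
    IsRadialSystem N ((2 - p) / (p - 1)) (q - 1) α w
      (fun r => phiP p (derivWithin w (Ici 0) r)) := by
  obtain ⟨hw, hP, heq, -, -⟩ := h
  have hd : ∀ f : ℝ → ℝ, ContDiffOn ℝ 1 f (Ici 0) → ∀ r, 0 < r →
      HasDerivAt f (derivWithin f (Ici 0) r) r := fun f hf r hr =>
    ((hf.differentiableOn one_ne_zero) r hr.le).hasDerivWithinAt.hasDerivAt (Ici_mem_nhds hr)
  refine ⟨fun r hr => ?_, fun r hr => ?_⟩
  · rw [abs_phiP_rpow_mul_phiP hp]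
    exact hd w hw r hr
  · rw [abs_phiP_rpow_mul_phiP hp]
    refine (hd _ hP r hr).congr_deriv ?_
    linarith [heq r hr]

/-- Assume `p < 2` and `N ≤ α < δ`, with `α* = δ + δ(N-δ)/((p-1)(2δ-N))`.
(i) If `α < α*`, every global solution `w(·,a)`, `a ≠ 0`, has finitely many zeros.
(ii) There exists `ᾱ ∈ (max(N,α*), δ)` such that for every `α' ∈ (ᾱ, δ)`, every
global solution (with parameter `α'`) `w(·,a)`, `a ≠ 0`, has infinitely many zeros. -/
theorem stmt17 (N : ℕ) (hN : 1 ≤ N) (p q α : ℝ) (hp : 1 < p) (hp2 : p < 2) (hq : 1 < q)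
    (hα1 : (N : ℝ) ≤ α) (hα2 : α < p / (2 - p)) :
    (α < p / (2 - p) + (p / (2 - p)) * ((N : ℝ) - p / (2 - p)) /
        ((p - 1) * (2 * (p / (2 - p)) - N)) →
      ∀ a : ℝ, a ≠ 0 → ∀ w : ℝ → ℝ, IsGlobalSolution N p q α a w →
        {r : ℝ | r ∈ Ici (0 : ℝ) ∧ w r = 0}.Finite) ∧
    (∃ ᾱ : ℝ,
      max (N : ℝ) (p / (2 - p) + (p / (2 - p)) * ((N : ℝ) - p / (2 - p)) /
        ((p - 1) * (2 * (p / (2 - p)) - N))) < ᾱ ∧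
      ᾱ < p / (2 - p) ∧
      ∀ α' : ℝ, ᾱ < α' → α' < p / (2 - p) →
        ∀ a : ℝ, a ≠ 0 → ∀ w : ℝ → ℝ, IsGlobalSolution N p q α' a w →
          {r : ℝ | r ∈ Ici (0 : ℝ) ∧ w r = 0}.Infinite) := by
  have hp1 : 0 < p - 1 := sub_pos.2 hp
  have hp2' : 0 < 2 - p := sub_pos.2 hp2
  have hN' : (1 : ℝ) ≤ N := by exact_mod_cast hN
  have hs : 0 < (2 - p) / (p - 1) := div_pos hp2' hp1
  have hk : 0 < q - 1 := sub_pos.2 hq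
  have hδs : (2 - p) / (p - 1) * (p / (2 - p) - 1) = 2 := by field_simp; ring
  have hs1 : (2 - p) / (p - 1) + 1 = 1 / (p - 1) := by field_simp; ring
  generalize p / (2 - p) = δ at *
  have hNδ : (N : ℝ) < δ := hα1.trans_lt hα2
  have hden : 0 < (p - 1) * (2 * δ - N) := mul_pos hp1 (by linarith)
  refine ⟨fun hstar a ha w hw => ?_, ?_⟩
  · refine (hw.isRadialSystem hp).finite_zeros hs hk hδs hN' hα1 hα2 ?_
      (hw.1.continuousOn 0 self_mem_Ici) (hw.2.2.2.1 ▸ ha)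
    rw [hs1, div_mul_eq_mul_div, one_mul, div_lt_iff₀ hp1]
    have h1 : α - δ < δ * (N - δ) / ((p - 1) * (2 * δ - N)) := by linarith
    rw [lt_div_iff₀ hden] at h1
    linarith
  · obtain ⟨ε, hε, hinf⟩ := exists_infinite_zeros_of_isRadialSystem hN' hs hk hδs hNδ
    have hstar : δ + δ * (N - δ) / ((p - 1) * (2 * δ - N)) < δ := by
      have := div_neg_of_neg_of_pos
        (mul_neg_of_pos_of_neg (by linarith : 0 < δ) (sub_neg.2 hNδ)) hden
      linarith
    obtain ⟨ᾱ, h1, h2⟩ := exists_between (max_lt (max_lt hNδ hstar) (sub_lt_self δ hε))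
    obtain ⟨h3, h4⟩ := max_lt_iff.1 h1
    refine ⟨ᾱ, h3, h2, fun α' h5 h6 a _ w hw => ?_⟩
    exact hinf α' w _ (((max_lt_iff.1 h3).1.trans h5).le) h6 (by linarith) (hw.isRadialSystem hp)
end

section
/- Assume p < 2 and either δ < α, or N ≤ α = δ. Then any solution w of equation (E) on an interval [r₀,∞) satisfies w(r) = O(r^{-δ}) and w'(r) = O(r^{-δ-1}) as r → ∞. -/
open Set Filter Topology Asymptotics

/-- A function that is nonincreasing wherever it exceeds `C` stays below `C`. -/
lemma le_of_deriv_nonpos_of_lt {f f' : ℝ → ℝ} {a C : ℝ}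
    (hf : ∀ x, a ≤ x → HasDerivAt f (f' x) x) (ha : f a ≤ C)
    (hC : ∀ x, a ≤ x → C < f x → f' x ≤ 0) {x : ℝ} (hx : a ≤ x) : f x ≤ C := by
  have key : ∀ e : ℝ, 0 < e → f x ≤ C + e * (1 + (x - a)) := by
    intro e he
    refine image_le_of_deriv_right_lt_deriv_boundary' (f := f) (f' := f') (a := a) (b := x)
      (B := fun t => C + e * (1 + (t - a))) (B' := fun _ => e)
      (fun t ht => (hf t ht.1).continuousAt.continuousWithinAt)
      (fun t ht => (hf t ht.1).hasDerivWithinAt) (by simp; linarith) (by fun_prop) ?_ ?_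
      ⟨hx, le_rfl⟩
    · intro t _
      have : HasDerivAt (fun t => C + e * (1 + (t - a))) (e * 1) t :=
        ((((hasDerivAt_id t).sub_const a).const_add 1).const_mul e).const_add C
      simpa using this.hasDerivWithinAt
    · intro t ht hft
      have : 0 ≤ e * (t - a) := mul_nonneg he.le (sub_nonneg.2 ht.1)
      exact (hC t ht.1 (by rw [hft]; linarith)).trans_lt he
  refine le_of_forall_pos_le_add fun e he => ?_
  have hpos : 0 < 1 + (x - a) := by linarith
  have := key (e / (1 + (x - a))) (by positivity)
  rwa [div_mul_cancel₀ _ hpos.ne'] at this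

lemma mul_phiP (p x : ℝ) : x * phiP p x = |x| ^ (p - 2) * x ^ 2 := by
  unfold phiP; ring

lemma mul_phiP_nonneg (p x : ℝ) : 0 ≤ x * phiP p x := by
  rw [mul_phiP]; positivity

lemma phiP_neg (p x : ℝ) : phiP p (-x) = -phiP p x := by
  simp [phiP]

lemma phiP_mul_of_pos (p x : ℝ) {c : ℝ} (hc : 0 < c) :
    phiP p (c * x) = c ^ (p - 1) * phiP p x := by
  unfold phiP
  rw [abs_mul, abs_of_pos hc, Real.mul_rpow hc.le (abs_nonneg x),
    show p - 1 = (p - 2) + 1 by ring, Real.rpow_add_one hc.ne']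
  ring

lemma phiP_conj_phiP {p : ℝ} (hp : 1 < p) (x : ℝ) : phiP (p / (p - 1)) (phiP p x) = x := by
  rcases eq_or_ne x 0 with rfl | hx
  · simp [phiP]
  have hx' : 0 < |x| := abs_pos.2 hx
  have hp' : p - 1 ≠ 0 := by linarith
  have h1 : |phiP p x| = |x| ^ (p - 1) := by
    unfold phiP
    rw [abs_mul, abs_of_pos (Real.rpow_pos_of_pos hx' _), ← Real.rpow_add_one hx'.ne']
    congr 1; ring
  rw [phiP, h1, ← Real.rpow_mul hx'.le, phiP, ← mul_assoc, ← Real.rpow_add hx']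
  have : (p - 1) * (p / (p - 1) - 2) + (p - 2) = 0 := by field_simp; ring
  rw [this, Real.rpow_zero, one_mul]

lemma exists_forall_le_abs_rpow {β : ℝ} (hβ : 0 < β) (M : ℝ) :
    ∃ K : ℝ, 0 < K ∧ ∀ Y : ℝ, K ≤ |Y| → M ≤ |Y| ^ β := by
  obtain ⟨K, hK⟩ := Filter.eventually_atTop.1 ((tendsto_rpow_atTop hβ).eventually_ge_atTop M)
  exact ⟨max K 1, by positivity, fun Y hY => hK _ ((le_max_left _ _).trans hY)⟩

/-- The orbital derivative of the Lyapunov function, in terms of the rescaled variables. -/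
def orbitalDeriv (δ η κ c ε y Y Z : ℝ) : ℝ :=
  -(Z - δ * y) ^ 2 + η * y * (Z - δ * y) - η * (η + 1) * y ^ 2 + η * (η + 1 + δ) * y * Y
    + κ * Y * ((Z - δ * y) - (η + 1) * y + (η + 1 + δ) * Y)
    + ε * (-c * y ^ 2 + (η + 1 + δ) * y * Y)

lemma source_term_le {c C ε ε₀ : ℝ} (hc : 0 < c) (hε : 0 ≤ ε) (hε₀ : ε ≤ ε₀) (y Y : ℝ) :
    ε * (-c * y ^ 2 + C * y * Y) ≤ ε₀ * (C ^ 2 / c) * Y ^ 2 := by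
  have h1 : -c * y ^ 2 + C * y * Y ≤ C ^ 2 / c * Y ^ 2 := by
    rw [div_mul_eq_mul_div, le_div_iff₀ hc]
    nlinarith [sq_nonneg (2 * c * y - C * Y), sq_nonneg (C * Y)]
  have h2 : 0 ≤ C ^ 2 / c * Y ^ 2 := by positivity
  calc _ ≤ ε * (C ^ 2 / c * Y ^ 2) := mul_le_mul_of_nonneg_left h1 hε
    _ ≤ ε₀ * (C ^ 2 / c * Y ^ 2) := mul_le_mul_of_nonneg_right hε₀ h2
    _ = _ := by ring

lemma orbitalDeriv_le_of_pos {δ η : ℝ} (κ : ℝ) {c ε₀ : ℝ} (hδ : 0 < δ)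
    (hη : 0 < η) (hc : 0 < c) (hε₀ : 0 ≤ ε₀) :
    ∃ C : ℝ, 0 ≤ C ∧ ∀ y Y Z ε : ℝ, 0 ≤ ε → ε ≤ ε₀ → orbitalDeriv δ η κ c ε y Y Z ≤
      -(Z - δ * y) ^ 2 / 4 - η / 2 * y ^ 2 + C * Y ^ 2 := by
  set A := η * (η + 1 + δ) - κ * (η + 1) with hA
  set C := A ^ 2 / (2 * η) + κ ^ 2 + |κ| * (η + 1 + δ) + ε₀ * ((η + 1 + δ) ^ 2 / c) with hC
  have hC0 : 0 ≤ C := by positivity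
  refine ⟨C, hC0, fun y Y Z ε h0 h1 => ?_⟩
  have e1 := source_term_le (C := η + 1 + δ) hc h0 h1 y Y
  have e2 : A * y * Y ≤ η / 2 * y ^ 2 + A ^ 2 / (2 * η) * Y ^ 2 := by
    have : η / 2 * y ^ 2 + A ^ 2 / (2 * η) * Y ^ 2 - A * y * Y
        = (η * y - A * Y) ^ 2 / (2 * η) := by field_simp; ring
    have : 0 ≤ (η * y - A * Y) ^ 2 / (2 * η) := by positivity
    linarith
  have e3 : κ * (η + 1 + δ) * Y ^ 2 ≤ |κ| * (η + 1 + δ) * Y ^ 2 := by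
    gcongr; exact le_abs_self κ
  have e4 := sq_nonneg ((Z - δ * y) - η * y)
  have e5 := sq_nonneg ((Z - δ * y) / 2 - κ * Y)
  have e6 := sq_nonneg (η * y)
  have e7 : η * (η + 1 + δ) * y * Y = A * y * Y + κ * (η + 1) * y * Y := by rw [hA]; ring
  have e8 : C * Y ^ 2 = A ^ 2 / (2 * η) * Y ^ 2 + κ ^ 2 * Y ^ 2 + |κ| * (η + 1 + δ) * Y ^ 2
      + ε₀ * ((η + 1 + δ) ^ 2 / c) * Y ^ 2 := by rw [hC]; ring
  unfold orbitalDeriv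
  rw [e8, e7]
  generalize A ^ 2 / (2 * η) * Y ^ 2 = a₁ at *
  generalize ε₀ * ((η + 1 + δ) ^ 2 / c) * Y ^ 2 = a₂ at *
  generalize ε * (-c * y ^ 2 + (η + 1 + δ) * y * Y) = a₃ at *
  linear_combination e1 + e2 + e3 + e4 / 2 + e5 + e6 / 2

lemma orbitalDeriv_nonpos_of_pos {β δ η : ℝ} (κ : ℝ) {c ε₀ : ℝ} (hβ : 0 < β) (hδ : 0 < δ)
    (hη : 0 < η) (hc : 0 < c) (hε₀ : 0 ≤ ε₀) :
    ∃ K : ℝ, 0 < K ∧ ∀ y Y ε : ℝ, 0 ≤ ε → ε ≤ ε₀ → K ≤ |y| ∨ K ≤ |Y| →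
      orbitalDeriv δ η κ c ε y Y (|Y| ^ β * Y) ≤ 0 := by
  obtain ⟨C, hC0, bound⟩ := orbitalDeriv_le_of_pos κ hδ hη hc hε₀
  set d := min (1 / 8) (η / (4 * δ ^ 2)) with hd
  have hd0 : 0 < d := by positivity
  have hd1 : d ≤ 1 / 8 := min_le_left _ _
  have hd2 : d * (4 * δ ^ 2) ≤ η := (le_div_iff₀ (by positivity)).1 (min_le_right _ _)
  obtain ⟨K, hK, hKM⟩ := exists_forall_le_abs_rpow hβ (C / d + 1)
  refine ⟨K * (1 + 2 * C / η), by positivity, fun y Y ε h0 h1 hor => ?_⟩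
  set Z := |Y| ^ β * Y
  refine (bound y Y Z ε h0 h1).trans ?_
  by_cases hY : K ≤ |Y|
  · have hM := hKM Y hY
    have hM1 : C / d ≤ (|Y| ^ β) ^ 2 := by
      have : 0 ≤ C / d := by positivity
      nlinarith
    have hZ : C * Y ^ 2 ≤ d * Z ^ 2 := by
      have := (div_le_iff₀ hd0).1 hM1
      calc C * Y ^ 2 ≤ ((|Y| ^ β) ^ 2 * d) * Y ^ 2 := by gcongr
        _ = _ := by ring
    have e1 : d * Z ^ 2 ≤ d * (2 * (Z - δ * y) ^ 2 + 2 * δ ^ 2 * y ^ 2) := by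
      gcongr; nlinarith [sq_nonneg (Z - 2 * δ * y)]
    nlinarith [mul_le_mul_of_nonneg_right hd1 (sq_nonneg (Z - δ * y)),
      mul_le_mul_of_nonneg_right hd2 (sq_nonneg y)]
  · push Not at hY
    have hC' : 0 ≤ 2 * C / η := by positivity
    have hy : K * (1 + 2 * C / η) ≤ |y| := by
      rcases hor with h | h
      · exact h
      · nlinarith
    have hYK : Y ^ 2 ≤ K ^ 2 := by
      rw [← sq_abs Y]; gcongr
    have hyK : K ^ 2 * (2 * C / η) ≤ y ^ 2 := by
      rw [← sq_abs y]
      calc K ^ 2 * (2 * C / η) ≤ (K * (1 + 2 * C / η)) ^ 2 := by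
            rw [mul_pow]; gcongr; nlinarith
        _ ≤ _ := by gcongr
    have e1 : C * K ^ 2 ≤ η / 2 * y ^ 2 := by
      calc C * K ^ 2 = η / 2 * (K ^ 2 * (2 * C / η)) := by field_simp
        _ ≤ _ := by gcongr
    linarith [mul_le_mul_of_nonneg_left hYK hC0, sq_nonneg (Z - δ * y)]

lemma orbitalDeriv_zero_nonpos_of_pos {β δ κ c ε₀ : ℝ} (hβ : 0 < β) (hδ : 0 < δ)
    (hκ : 0 < κ) (hc : 0 < c) (hε₀ : 0 ≤ ε₀) :
    ∃ K : ℝ, 0 < K ∧ ∀ y Y ε : ℝ, 0 ≤ ε → ε ≤ ε₀ → K ≤ |y| ∨ K ≤ |Y| →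
      orbitalDeriv δ 0 κ c ε y Y (|Y| ^ β * Y) ≤ 0 := by
  set A := κ * (1 + 1 / δ) with hA
  set C := A ^ 2 / 2 + κ * (1 + δ) + ε₀ * ((1 + δ) ^ 2 / c) with hC
  have hC0 : 0 ≤ C := by positivity
  have bound : ∀ y Y Z ε : ℝ, 0 ≤ ε → ε ≤ ε₀ → orbitalDeriv δ 0 κ c ε y Y Z ≤
      -(Z - δ * y) ^ 2 / 2 - κ / δ * (Y * Z) + C * Y ^ 2 := by
    intro y Y Z ε h0 h1
    have e1 := source_term_le (C := 1 + δ) hc h0 h1 y Y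
    have e2 : κ * Y * ((Z - δ * y) - y) = A * (Y * (Z - δ * y)) - κ / δ * (Y * Z) := by
      rw [hA]; field_simp; ring
    have e3 := sq_nonneg ((Z - δ * y) - A * Y)
    unfold orbitalDeriv
    rw [hC]
    nlinarith
  obtain ⟨K, hK, hKM⟩ := exists_forall_le_abs_rpow hβ (C * δ / κ)
  set B := K ^ β * K with hB
  have hB0 : 0 ≤ B := by positivity
  set T := 1 + 2 * C * K ^ 2 with hT
  have hT0 : 1 ≤ T := by rw [hT]; nlinarith [mul_nonneg hC0 (sq_nonneg K)]
  refine ⟨K + (B + T) / δ, by positivity, fun y Y ε h0 h1 hor => ?_⟩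
  refine (bound y Y _ ε h0 h1).trans ?_
  have hYZ : Y * (|Y| ^ β * Y) = |Y| ^ β * Y ^ 2 := by ring
  rw [hYZ]
  by_cases hY : K ≤ |Y|
  · have hM := hKM Y hY
    have : C * Y ^ 2 ≤ κ / δ * (|Y| ^ β * Y ^ 2) := by
      calc C * Y ^ 2 = κ / δ * (C * δ / κ * Y ^ 2) := by field_simp
        _ ≤ _ := by gcongr
    nlinarith [sq_nonneg (|Y| ^ β * Y - δ * y)]
  · push Not at hY
    have hq : 0 < (B + T) / δ := by positivity
    have hy : (B + T) / δ ≤ |y| := by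
      rcases hor with h | h <;> linarith
    rw [div_le_iff₀ hδ] at hy
    have hZ : |(|Y| ^ β * Y)| ≤ B := by
      rw [abs_mul, abs_of_nonneg (by positivity : 0 ≤ |Y| ^ β)]
      rw [hB]; gcongr
    have hD : T ≤ |(|Y| ^ β * Y) - δ * y| := by
      have := abs_sub_abs_le_abs_sub (δ * y) (|Y| ^ β * Y)
      rw [abs_mul, abs_of_pos hδ, abs_sub_comm] at this
      linarith
    have hD2 : T ≤ ((|Y| ^ β * Y) - δ * y) ^ 2 := by
      rw [← sq_abs]; nlinarith
    have hYK : C * Y ^ 2 ≤ C * K ^ 2 := by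
      rw [← sq_abs Y]; gcongr
    have : 0 ≤ κ / δ * (|Y| ^ β * Y ^ 2) := by positivity
    linarith

lemma orbitalDeriv_zero_zero_nonpos {β δ c ε₀ : ℝ} (hβ : 0 < β) (hδ : 0 < δ)
    (hc : 0 < c) (hε₀ : 0 ≤ ε₀) :
    ∃ K : ℝ, 0 < K ∧ ∀ y Y ε : ℝ, 0 ≤ ε → ε ≤ ε₀ → K ≤ |y| ∨ K ≤ |Y| →
      orbitalDeriv δ 0 0 c ε y Y (|Y| ^ β * Y) ≤ 0 := by
  set m := (1 + δ) / c with hm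
  set C := ε₀ * ((1 + δ) ^ 2 / c) with hC
  have hC0 : 0 ≤ C := by positivity
  have hm0 : 0 < m := by positivity
  obtain ⟨K, hK, hKM⟩ := exists_forall_le_abs_rpow hβ (δ * m + 1 + C)
  refine ⟨K * (1 + m), by positivity, fun y Y ε h0 h1 hor => ?_⟩
  have e1 := source_term_le (C := 1 + δ) hc h0 h1 y Y
  unfold orbitalDeriv
  by_cases hy : m * |Y| ≤ |y|
  · have : -c * y ^ 2 + (1 + δ) * y * Y ≤ 0 := by
      rw [hm, div_mul_eq_mul_div, div_le_iff₀ hc] at hy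
      have h3 : (1 + δ) * (y * Y) ≤ (1 + δ) * (|y| * |Y|) := by
        rw [← abs_mul]; gcongr; exact le_abs_self _
      have h4 := mul_le_mul_of_nonneg_left hy (abs_nonneg y)
      nlinarith [sq_abs y]
    nlinarith [mul_nonpos_of_nonneg_of_nonpos h0 this,
      sq_nonneg (|Y| ^ β * Y - δ * y)]
  · push Not at hy
    have hY : K ≤ |Y| := by
      rcases hor with h | h
      · by_contra! h'
        nlinarith [mul_lt_mul_of_pos_left h' hm0]
      · nlinarith
    have hM := hKM Y hY
    have hZ : |(|Y| ^ β * Y)| = |Y| ^ β * |Y| := by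
      rw [abs_mul, abs_of_nonneg (by positivity : 0 ≤ |Y| ^ β)]
    have hD : (1 + C) * |Y| ≤ |(|Y| ^ β * Y) - δ * y| := by
      have h2 := abs_sub_abs_le_abs_sub (|Y| ^ β * Y) (δ * y)
      rw [hZ, abs_mul, abs_of_pos hδ] at h2
      nlinarith [mul_le_mul_of_nonneg_right hM (abs_nonneg Y)]
    have hD2 : C * Y ^ 2 ≤ ((|Y| ^ β * Y) - δ * y) ^ 2 := by
      rw [← sq_abs (_ - _)]
      calc C * Y ^ 2 ≤ ((1 + C) * |Y|) ^ 2 := by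
            rw [mul_pow, sq_abs]; gcongr; nlinarith
        _ ≤ _ := by gcongr
    nlinarith

lemma exists_orbitalDeriv_nonpos {β δ η κ c ε₀ : ℝ} (hβ : 0 < β) (hδ : 0 < δ)
    (hηκ : 0 < η ∨ (η = 0 ∧ 0 ≤ κ)) (hc : 0 < c) (hε₀ : 0 ≤ ε₀) :
    ∃ K : ℝ, 0 < K ∧ ∀ y Y ε : ℝ, 0 ≤ ε → ε ≤ ε₀ → K ≤ |y| ∨ K ≤ |Y| →
      orbitalDeriv δ η κ c ε y Y (|Y| ^ β * Y) ≤ 0 := by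
  rcases hηκ with hη | ⟨rfl, hκ⟩
  · exact orbitalDeriv_nonpos_of_pos κ hβ hδ hη hc hε₀
  · rcases hκ.eq_or_lt with rfl | hκ
    · exact orbitalDeriv_zero_zero_nonpos hβ hδ hc hε₀
    · exact orbitalDeriv_zero_nonpos_of_pos hβ hδ hκ hc hε₀

/-- The autonomous part of the Lyapunov function. -/
noncomputable def lyapunov (P δ s y Y : ℝ) : ℝ :=
  |Y| ^ P / P - δ * (y - Y) * Y - δ / 2 * Y ^ 2 + s / 2 * (y - Y) ^ 2

lemma exists_abs_le_of_lyapunov_le {P δ s : ℝ} (hP : 2 < P) (hδ : 0 < δ) (hs : 0 < s) (C : ℝ) :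
    ∃ B : ℝ, ∀ y Y : ℝ, lyapunov P δ s y Y ≤ C → |y| ≤ B ∧ |Y| ≤ B := by
  set m := δ ^ 2 / s + δ / 2 with hm
  have hm0 : 0 < m := by positivity
  obtain ⟨K, hK, hKM⟩ := exists_forall_le_abs_rpow (β := P - 2) (by linarith) (P * (m + 1))
  set B₁ := |C| + (m + 1) * K ^ 2 + 1 with hB₁
  have hB₁1 : 1 ≤ B₁ := by
    have : 0 ≤ |C| + (m + 1) * K ^ 2 := by positivity
    linarith
  refine ⟨(B₁ + (4 / s) * B₁ + 1) + B₁, fun y Y h => ?_⟩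
  have hlow : s / 4 * (y - Y) ^ 2 + |Y| ^ P / P - m * Y ^ 2 ≤ C := by
    refine le_trans ?_ h
    have : lyapunov P δ s y Y - (s / 4 * (y - Y) ^ 2 + |Y| ^ P / P - m * Y ^ 2)
        = (s * (y - Y) - 2 * δ * Y) ^ 2 / (4 * s) := by
      unfold lyapunov; rw [hm]; field_simp; ring
    have : 0 ≤ (s * (y - Y) - 2 * δ * Y) ^ 2 / (4 * s) := by positivity
    linarith
  have hΦ : (m + 1) * Y ^ 2 ≤ |Y| ^ P / P + (m + 1) * K ^ 2 := by
    by_cases hY : K ≤ |Y|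
    · have hY0 : 0 < |Y| := hK.trans_le hY
      have h1 : |Y| ^ P = |Y| ^ (P - 2) * Y ^ 2 := by
        rw [← sq_abs Y, ← Real.rpow_natCast, ← Real.rpow_add hY0]; congr 1; push_cast; ring
      have h2 : (m + 1) * Y ^ 2 ≤ |Y| ^ P / P := by
        rw [h1, le_div_iff₀ (by linarith)]
        nlinarith [mul_le_mul_of_nonneg_right (hKM Y hY) (sq_nonneg Y)]
      have : 0 ≤ (m + 1) * K ^ 2 := by positivity
      linarith
    · push Not at hY
      have : 0 ≤ |Y| ^ P / P := by positivity
      have : Y ^ 2 ≤ K ^ 2 := by rw [← sq_abs Y]; gcongr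
      nlinarith
  have hsum : s / 4 * (y - Y) ^ 2 + Y ^ 2 ≤ B₁ := by
    rw [hB₁]; linarith [le_abs_self C]
  have hu0 : 0 ≤ s / 4 * (y - Y) ^ 2 := by positivity
  have hY : |Y| ≤ B₁ := by
    have : Y ^ 2 ≤ B₁ ^ 2 := by nlinarith
    exact abs_le_of_sq_le_sq this (by linarith)
  have hu : |y - Y| ≤ 4 / s * B₁ + 1 := by
    have h0 : 0 ≤ 4 / s * B₁ := by positivity
    have : (y - Y) ^ 2 ≤ 4 / s * B₁ := by
      calc (y - Y) ^ 2 = 4 / s * (s / 4 * (y - Y) ^ 2) := by field_simp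
        _ ≤ _ := by gcongr; linarith [sq_nonneg Y]
    exact abs_le_of_sq_le_sq (by nlinarith) (by linarith)
  have h0 : 0 ≤ 4 / s * B₁ := by positivity
  have : |y| ≤ |y - Y| + |Y| := by simpa using abs_add_le (y - Y) Y
  constructor <;> linarith

lemma lyapunov_le {P δ s y Y K : ℝ} (hP : 2 < P) (hδ : 0 < δ) (hs : 0 < s)
    (hy : |y| ≤ K) (hY : |Y| ≤ K) :
    lyapunov P δ s y Y ≤ K ^ P / P + 2 * δ * K ^ 2 + 2 * s * K ^ 2 := by
  have hK : 0 ≤ K := (abs_nonneg y).trans hy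
  have h1 : |Y| ^ P / P ≤ K ^ P / P := by gcongr
  have hu : |y - Y| ≤ 2 * K := (abs_sub y Y).trans (by linarith)
  have h2 : -((y - Y) * Y) ≤ 2 * K * K := by
    refine (neg_le_abs _).trans ?_
    rw [abs_mul]; gcongr
  have h3 : (y - Y) ^ 2 ≤ (2 * K) ^ 2 := by rw [← sq_abs (y - Y)]; gcongr
  unfold lyapunov
  nlinarith [mul_le_mul_of_nonneg_left h2 hδ.le, mul_le_mul_of_nonneg_left h3 hs.le,
    mul_nonneg hδ.le (sq_nonneg Y)]

lemma hasDerivAt_abs_phiP_rpow {p : ℝ} (hp : 1 < p) {v : ℝ → ℝ} {f' r : ℝ}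
    (h : HasDerivAt (fun s => phiP p (v s)) f' r) :
    HasDerivAt (fun s => |phiP p (v s)| ^ (p / (p - 1)) / (p / (p - 1))) (v r * f') r := by
  have hP : 1 < p / (p - 1) := by rw [lt_div_iff₀ (by linarith)]; linarith
  have h1 := ((hasDerivAt_abs_rpow (phiP p (v r)) hP).comp r h).div_const (p / (p - 1))
  have h2 := phiP_conj_phiP hp (v r)
  unfold phiP at h2
  refine h1.congr_deriv ?_
  have hP0 : p / (p - 1) ≠ 0 := by positivity
  unfold phiP
  rw [mul_assoc (p / (p - 1)), h2, mul_assoc, mul_div_cancel_left₀ _ hP0]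

/-- Boundedness of `|w|^{q-1}`, from the decay of the natural energy. -/
lemma exists_abs_rpow_le_of_equation {N : ℕ} (hN : 1 ≤ N) {p q α a : ℝ} (hp : 1 < p) (hq : 1 < q)
    (hα : 0 < α) (ha : 0 < a) {w v : ℝ → ℝ} (hw : ∀ r, a ≤ r → HasDerivAt w (v r) r)
    (hv : ∀ r, a ≤ r → HasDerivAt (fun s => phiP p (v s))
      (-(((N : ℝ) - 1) / r * phiP p (v r) + r * v r + α * w r + |w r| ^ (q - 1) * w r)) r) :
    ∃ C : ℝ, 0 ≤ C ∧ ∀ r, a ≤ r → |w r| ^ (q - 1) ≤ C := by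
  set E : ℝ → ℝ := fun r => |phiP p (v r)| ^ (p / (p - 1)) / (p / (p - 1)) + α / 2 * w r ^ 2
    + |w r| ^ (q + 1) / (q + 1) with hE
  have hN' : (0 : ℝ) ≤ (N : ℝ) - 1 := by simpa using hN
  have hdE : ∀ r, a ≤ r → HasDerivAt E
      (-((N - 1) / r * (v r * phiP p (v r)) + r * v r ^ 2)) r := by
    intro r hr
    have h1 := hasDerivAt_abs_phiP_rpow hp (hv r hr)
    have h2 := ((hw r hr).pow 2).const_mul (α / 2)
    have h3 := ((hasDerivAt_abs_rpow (w r) (p := q + 1) (by linarith)).comp r (hw r hr)).div_const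
      (q + 1)
    refine ((h1.add h2).add h3).congr_deriv ?_
    have : q + 1 ≠ 0 := by positivity
    rw [show q + 1 - 2 = q - 1 by ring]
    field_simp
    ring
  have hEa : ∀ r, a ≤ r → E r ≤ E a := fun r hr =>
    le_of_deriv_nonpos_of_lt hdE le_rfl (fun x hx _ => by
      have hx0 : 0 < x := ha.trans_le hx
      have := mul_phiP_nonneg p (v x)
      have : 0 ≤ (N - 1) / x * (v x * phiP p (v x)) + x * v x ^ 2 := by positivity
      linarith) hr
  have hP : 0 < p / (p - 1) := div_pos (by linarith) (by linarith)
  have hEa0 : 0 ≤ E a := by simp only [hE]; positivity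
  refine ⟨(2 / α * E a + 1) ^ (q - 1), by positivity, fun r hr => ?_⟩
  have hwE : α / 2 * w r ^ 2 ≤ E a := by
    refine le_trans ?_ (hEa r hr)
    have h1 : 0 ≤ |phiP p (v r)| ^ (p / (p - 1)) / (p / (p - 1)) := by positivity
    have h2 : 0 ≤ |w r| ^ (q + 1) / (q + 1) := by positivity
    simp only [hE]; linarith
  have h0 : 0 ≤ 2 / α * E a := by positivity
  have hw2 : w r ^ 2 ≤ 2 / α * E a := by
    calc w r ^ 2 = 2 / α * (α / 2 * w r ^ 2) := by field_simp
      _ ≤ _ := by gcongr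
  have : |w r| ≤ 2 / α * E a + 1 := abs_le_of_sq_le_sq (by nlinarith) (by linarith)
  exact Real.rpow_le_rpow (abs_nonneg _) this (by linarith)

lemma HasDerivAt.rpow_mul {f : ℝ → ℝ} {f' r : ℝ} (b : ℝ) (hr : 0 < r) (hf : HasDerivAt f f' r) :
    HasDerivAt (fun s => s ^ b * f s) (r ^ b * (b * f r + r * f') / r) r := by
  refine ((Real.hasDerivAt_rpow_const (p := b) (Or.inl hr.ne')).mul hf).congr_deriv ?_
  rw [Real.rpow_sub_one hr.ne']
  field_simp

lemma exists_rescaled_bound {N : ℕ} (hN : 1 ≤ N) {p q α a : ℝ} (hp : 1 < p) (hp2 : p < 2)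
    (hq : 1 < q) (hα : 0 < α)
    (h : p / (2 - p) < α ∨ ((N : ℝ) ≤ α ∧ α = p / (2 - p))) (ha : 0 < a) {w v : ℝ → ℝ}
    (hw : ∀ r, a ≤ r → HasDerivAt w (v r) r)
    (hv : ∀ r, a ≤ r → HasDerivAt (fun s => phiP p (v s))
      (-(((N : ℝ) - 1) / r * phiP p (v r) + r * v r + α * w r + |w r| ^ (q - 1) * w r)) r) :
    ∃ B : ℝ, ∀ r, a ≤ r → |r ^ (p / (2 - p)) * w r| ≤ B ∧
      |r ^ (p / (2 - p) + 1) * v r| ≤ B := by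
  obtain ⟨ε₀, hε₀, hε⟩ := exists_abs_rpow_le_of_equation hN hp hq hα ha hw hv
  set δ := p / (2 - p) with hδdef
  set P := p / (p - 1) with hPdef
  have hδ : 0 < δ := div_pos (by linarith) (by linarith)
  have hP : 2 < P := by rw [hPdef, lt_div_iff₀ (by linarith)]; linarith
  have hexp : (δ + 1) * (p - 1) = δ - 1 := by
    have : 2 - p ≠ 0 := by linarith
    rw [hδdef]; field_simp; ring
  set η := α - δ with hη
  set κ := δ - N with hκ
  have hηκ : 0 < η ∨ (η = 0 ∧ 0 ≤ κ) := by
    rcases h with h | ⟨h1, h2⟩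
    · left; linarith
    · right; constructor <;> linarith
  have hη0 : 0 ≤ η := by rcases hηκ with h | h <;> linarith
  set c := η + 1 + δ - 2 * δ / (q + 1) with hc
  have hc0 : 0 < c := by
    have : 2 * δ / (q + 1) ≤ δ := by rw [div_le_iff₀ (by linarith)]; nlinarith
    linarith
  set y : ℝ → ℝ := fun r => r ^ δ * w r with hy
  set Y : ℝ → ℝ := fun r => -(r ^ (δ - 1) * phiP p (v r)) with hY
  set Z : ℝ → ℝ := fun r => -(r ^ (δ + 1) * v r) with hZ
  set ε : ℝ → ℝ := fun r => |w r| ^ (q - 1) with hεdef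
  have hYZ : ∀ r, 0 < r → Y r = phiP p (Z r) := by
    intro r hr
    simp only [hY, hZ]
    rw [phiP_neg, phiP_mul_of_pos _ _ (by positivity), ← Real.rpow_mul hr.le, hexp]
  have hZY : ∀ r, 0 < r → Z r = |Y r| ^ (P - 2) * Y r := by
    intro r hr
    rw [hYZ r hr]; exact (phiP_conj_phiP hp (Z r)).symm
  have hdy : ∀ r, a ≤ r → HasDerivAt y ((δ * y r - Z r) / r) r := by
    intro r hr
    have hr0 := ha.trans_le hr
    refine ((hw r hr).rpow_mul δ hr0).congr_deriv ?_
    simp only [hy, hZ]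
    rw [Real.rpow_add_one hr0.ne']; ring
  have hdY : ∀ r, a ≤ r → HasDerivAt Y ((κ * Y r - Z r + (α + ε r) * y r) / r) r := by
    intro r hr
    have hr0 := ha.trans_le hr
    refine ((hv r hr).rpow_mul (δ - 1) hr0).neg.congr_deriv ?_
    simp only [hy, hZ, hY, hεdef, hκ]
    rw [Real.rpow_add_one hr0.ne', Real.rpow_sub_one hr0.ne']
    field_simp
    ring
  have hdΦ : ∀ r, a ≤ r → HasDerivAt (fun s => |Y s| ^ P / P)
      (Z r * ((κ * Y r - Z r + (α + ε r) * y r) / r)) r := by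
    intro r hr
    have hev : (fun s => phiP p (Z s)) =ᶠ[𝓝 r] Y := by
      filter_upwards [eventually_gt_nhds (ha.trans_le hr)] with s hs using (hYZ s hs).symm
    refine (hasDerivAt_abs_phiP_rpow hp ((hdY r hr).congr_of_eventuallyEq hev)).congr_of_eventuallyEq
      ?_
    filter_upwards [hev] with s hs
    rw [hs]
  have hG : ∀ r, 0 < r → r ^ (2 * δ) * |w r| ^ (q + 1) = ε r * y r ^ 2 := by
    intro r hr
    have h1 : |w r| ^ (q + 1) = |w r| ^ (q - 1) * w r ^ 2 := by
      rw [← sq_abs (w r), ← Real.rpow_natCast,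
        ← Real.rpow_add_of_nonneg (abs_nonneg _) (by linarith) (by simp)]
      congr 1; push_cast; ring
    have h2 : r ^ (2 * δ) = (r ^ δ) ^ 2 := by
      rw [← Real.rpow_natCast, ← Real.rpow_mul hr.le]; congr 1; push_cast; ring
    simp only [hεdef, hy]
    rw [h1, h2]; ring
  have hdG : ∀ r, a ≤ r → HasDerivAt (fun s => s ^ (2 * δ) * |w s| ^ (q + 1) / (q + 1))
      ((2 * δ / (q + 1) * ε r * y r ^ 2 - ε r * y r * Z r) / r) r := by
    intro r hr
    have hr0 := ha.trans_le hr
    have h1 := (hasDerivAt_abs_rpow (w r) (p := q + 1) (by linarith)).comp r (hw r hr)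
    refine ((h1.rpow_mul (2 * δ) hr0).div_const (q + 1)).congr_deriv ?_
    have h2 := hG r hr0
    have h3 : r ^ (2 * δ) = r ^ δ * r ^ δ := by rw [two_mul, Real.rpow_add hr0]
    have hq0 : q + 1 ≠ 0 := by positivity
    have h4 : r ^ (2 * δ) * (2 * δ * |w r| ^ (q + 1)) = 2 * δ * (ε r * y r ^ 2) := by
      rw [← h2]; ring
    simp only [Function.comp_apply]
    rw [mul_add, h4, h3, show q + 1 - 2 = q - 1 by ring]
    simp only [hZ, hy, hεdef]
    rw [Real.rpow_add_one hr0.ne']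
    field_simp
    ring
  set L : ℝ → ℝ := fun r => lyapunov P δ (η + 1) (y r) (Y r)
    + r ^ (2 * δ) * |w r| ^ (q + 1) / (q + 1) with hL
  have hdL : ∀ r, a ≤ r → HasDerivAt L (orbitalDeriv δ η κ c (ε r) (y r) (Y r) (Z r) / r) r := by
    intro r hr
    have hu := (hdy r hr).sub (hdY r hr)
    have hd := ((((hdΦ r hr).sub ((hu.const_mul δ).mul (hdY r hr))).sub
      (((hdY r hr).pow 2).const_mul (δ / 2))).add ((hu.pow 2).const_mul ((η + 1) / 2))).add
      (hdG r hr)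
    refine hd.congr_deriv ?_
    have hα' : α = η + δ := by rw [hη]; ring
    simp only [orbitalDeriv, hc, hα', Pi.sub_apply]
    have hr0 := ha.trans_le hr
    field_simp
    ring
  obtain ⟨K, hK, hKneg⟩ := exists_orbitalDeriv_nonpos (β := P - 2) (by linarith) hδ hηκ hc0 hε₀
  set M := K ^ P / P + 2 * δ * K ^ 2 + 2 * (η + 1) * K ^ 2 + ε₀ * K ^ 2 / (q + 1) with hM
  have hLle : ∀ r, a ≤ r → L r ≤ max (L a) M := by
    intro r hr
    refine le_of_deriv_nonpos_of_lt hdL (le_max_left _ _) (fun x hx hlt => ?_) hr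
    have hx0 := ha.trans_le hx
    have hor : K ≤ |y x| ∨ K ≤ |Y x| := by
      by_contra! hcon
      have h1 := lyapunov_le (P := P) (δ := δ) (s := η + 1) hP hδ (by linarith)
        hcon.1.le hcon.2.le
      have h2 : x ^ (2 * δ) * |w x| ^ (q + 1) / (q + 1) ≤ ε₀ * K ^ 2 / (q + 1) := by
        rw [hG x hx0, ← sq_abs (y x)]
        have h3 := hε x hx
        have h4 := hcon.1.le
        gcongr
      have h5 := (le_max_right (L a) M).trans_lt hlt
      simp only [hL, hM] at h5
      linarith
    have h6 := hKneg (y x) (Y x) (ε x) (by positivity) (hε x hx) hor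
    rw [← hZY x hx0] at h6
    exact div_nonpos_of_nonpos_of_nonneg h6 hx0.le
  obtain ⟨B, hB⟩ := exists_abs_le_of_lyapunov_le (P := P) (s := η + 1) hP hδ (by linarith)
    (max (L a) M)
  refine ⟨max B (B ^ (P - 2) * B), fun r hr => ?_⟩
  have hr0 := ha.trans_le hr
  have hlyap : lyapunov P δ (η + 1) (y r) (Y r) ≤ max (L a) M := by
    refine le_trans ?_ (hLle r hr)
    have : 0 ≤ r ^ (2 * δ) * |w r| ^ (q + 1) / (q + 1) := by positivity
    simp only [hL]; linarith
  obtain ⟨h1, h2⟩ := hB _ _ hlyap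
  refine ⟨h1.trans (le_max_left _ _), le_trans ?_ (le_max_right _ _)⟩
  have h3 : |r ^ (δ + 1) * v r| = |Y r| ^ (P - 2) * |Y r| := by
    rw [← abs_neg]
    change |Z r| = _
    rw [hZY r hr0, abs_mul, abs_of_nonneg (by positivity : 0 ≤ |Y r| ^ (P - 2))]
  rw [h3]
  have : 0 ≤ B := (abs_nonneg _).trans h2
  gcongr

lemma isBigO_rpow_neg_of_abs_rpow_mul_le {f : ℝ → ℝ} {b B a : ℝ}
    (h : ∀ r, a ≤ r → |r ^ b * f r| ≤ B) : f =O[atTop] fun r : ℝ => r ^ (-b) := by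
  refine IsBigO.of_bound B ?_
  filter_upwards [eventually_ge_atTop a, eventually_gt_atTop 0] with r hr hr0
  have h1 := h r hr
  have hpos : 0 < r ^ b := Real.rpow_pos_of_pos hr0 b
  rw [abs_mul, abs_of_pos hpos] at h1
  rw [Real.rpow_neg hr0.le, Real.norm_eq_abs, Real.norm_of_nonneg (by positivity),
    ← div_eq_mul_inv, le_div_iff₀ hpos]
  linarith

/-- Assume `p < 2` and either `δ < α` or `N ≤ α = δ`. Then any solution of (E) on
`[r₀,∞)` satisfies `w(r) = O(r^{-δ})` and `w'(r) = O(r^{-δ-1})` as `r → ∞`. -/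
theorem stmt18 (N : ℕ) (hN : 1 ≤ N) (p q α : ℝ) (hp : 1 < p) (hp2 : p < 2) (hq : 1 < q)
    (hα : 0 < α) (h : p / (2 - p) < α ∨ ((N : ℝ) ≤ α ∧ α = p / (2 - p)))
    (r₀ : ℝ) (hr₀ : 0 < r₀) (w : ℝ → ℝ) (hw : IsSolutionOn N p q α w (Ici r₀)) :
    (w =O[atTop] fun r : ℝ => r ^ (-(p / (2 - p)))) ∧
    ((fun r => derivWithin w (Ici r₀) r) =O[atTop] fun r : ℝ => r ^ (-(p / (2 - p)) - 1)) := by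
  obtain ⟨hw1, hw2, heq⟩ := hw
  have hderiv : ∀ f : ℝ → ℝ, ContDiffOn ℝ 1 f (Ici r₀) → ∀ r, r₀ + 1 ≤ r →
      HasDerivAt f (derivWithin f (Ici r₀) r) r := by
    intro f hf r hr
    have hr' : r₀ < r := by linarith
    exact ((hf.differentiableOn one_ne_zero r hr'.le).hasDerivWithinAt).hasDerivAt
      (Ici_mem_nhds hr')
  obtain ⟨B, hB⟩ := exists_rescaled_bound hN hp hp2 hq hα h (by linarith : 0 < r₀ + 1)
    (hderiv w hw1) (fun r hr => (hderiv _ hw2 r hr).congr_deriv (by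
      linarith [heq r (show r₀ ≤ r by linarith)]))
  refine ⟨isBigO_rpow_neg_of_abs_rpow_mul_le fun r hr => (hB r hr).1, ?_⟩
  rw [show -(p / (2 - p)) - 1 = -(p / (2 - p) + 1) by ring]
  exact isBigO_rpow_neg_of_abs_rpow_mul_le fun r hr => (hB r hr).2
end
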